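/- Let D ∈ X^n with q = k/n < 1, and let D′ be obtained from D either by removing one element or by adding one element, with k ≤ min(|D|,|D′|). Then for every α > 1, the T-step FSwoR DP-SGD mechanism satisfies D_α( M_{[0,T]}(D) ‖ M_{[0,T]}(D′) ) ≤ Σ_{t=0}^{T−1} (1/(α−1))·log[ 1 + (q²/2)·α·(α−1)·M_{σ_t,2} + R̃_{α,σ_t,3}(q) ]. -/

import Mathlib

open MeasureTheory Finset

noncomputable section

/-- `p`-dimensional Gaussian density with mean `μ` and covariance `s² I`. -/
def gaussND {p : ℕ} (μ : EuclideanSpace ℝ (Fin p)) (s : ℝ)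
    (x : EuclideanSpace ℝ (Fin p)) : ℝ :=
  (2 * Real.pi * s ^ 2) ^ (-(p : ℝ) / 2) * Real.exp (-‖x - μ‖ ^ 2 / (2 * s ^ 2))

/-- one-dimensional Gaussian density with mean `μ` and variance `s²`. -/
def gauss1 (μ s θ : ℝ) : ℝ :=
  (2 * Real.pi * s ^ 2) ^ (-(1 : ℝ) / 2) * Real.exp (-(θ - μ) ^ 2 / (2 * s ^ 2))

/-- Rényi divergence of order `α` between densities `P` and `Q` w.r.t. the measure `ν`. -/
def renyiDiv {Ω : Type*} [MeasurableSpace Ω] (ν : Measure Ω) (α : ℝ) (P Q : Ω → ℝ) : ℝ :=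
  (α - 1)⁻¹ * Real.log (∫ x, (P x / Q x) ^ α * Q x ∂ν)

/-- `M_{σ,k} = ∫ (N_{1,σ²/4}/N_{0,σ²/4} − 1)^k N_{0,σ²/4}`. -/
def Mcoef (σ : ℝ) (k : ℕ) : ℝ :=
  ∫ θ : ℝ, (gauss1 1 (σ / 2) θ / gauss1 0 (σ / 2) θ - 1) ^ k * gauss1 0 (σ / 2) θ

/-- `B̃_{σ,j}`. -/
def Btil (σ : ℝ) (j : ℕ) : ℝ :=
  if Even j then Mcoef σ j else Real.sqrt (Mcoef σ (j - 1) * Mcoef σ (j + 1))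

/-- `H_{α,σ}(q)`. -/
def Hfun (α σ q : ℝ) : ℝ :=
  ∫ θ : ℝ, (q * (gauss1 1 (σ / 2) θ / gauss1 0 (σ / 2) θ) + (1 - q)) ^ α * gauss1 0 (σ / 2) θ

/-- `R̃_{α,σ,3}(q)`. -/
def Rtil3 (α σ q : ℝ) : ℝ :=
  if 3 < α then
    q ^ 3 * α * (α - 1) * |α - 2| *
      ((∑ ℓ ∈ Finset.range (⌈α⌉₊ - 3 + 1),
          q ^ ℓ * ((⌈α⌉₊ - 3).factorial : ℝ) /
            (((⌈α⌉₊ - 3 - ℓ).factorial : ℝ) * ((3 + ℓ).factorial : ℝ)) * Btil σ (ℓ + 3)) +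
        1 / 6 * Btil σ 3)
  else
    q ^ 3 * α * (α - 1) * |α - 2| * (1 / 6 * (1 - q) ^ (α - 3) * Btil σ 3)

/-- `F̃_{α,σ,k}`. -/
def Ftil (α σ : ℝ) (k : ℕ) : ℝ :=
  (α - 1) * α ^ (k - 1) *
      (if Even k then 4 * Mcoef σ k else 3 * Real.sqrt (Mcoef σ (k - 1) * Mcoef σ (k + 1))) +
    (α - 1) * α ^ (k - 1) *
      ∑ j ∈ Finset.range (k + 1),
        (k.choose j : ℝ) *
          |α / (α - 1) * (∏ ℓ ∈ Finset.range j, (1 - (ℓ : ℝ) / α)) *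
              (∏ ℓ ∈ Finset.range (k - j), (1 + ((ℓ : ℝ) - 1) / α)) - 1| *
          Btil σ k

/-- `Ẽ_{α,σ,m}(q)`. -/
def Etil (α σ : ℝ) (m : ℕ) (q : ℝ) : ℝ :=
  (q ^ m / (m.factorial : ℝ)) *
    ∑ j ∈ Finset.range (m + 1),
      (1 - q) ^ (-(α + (m : ℝ) - (j : ℝ) - 1)) * (m.choose j : ℝ) *
        (∏ ℓ ∈ Finset.range j, |α - (ℓ : ℝ)|) *
        (∏ ℓ ∈ Finset.range (m - j), (α + (ℓ : ℝ) - 1)) *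
        (if α ≤ (j : ℝ) then (1 - q) ^ (α - (j : ℝ)) * Btil σ m
         else Btil σ m + ∑ ℓ ∈ Finset.range (⌈α⌉₊ - j + 1),
           q ^ ℓ * ((⌈α⌉₊ - j).factorial : ℝ) * (m.factorial : ℝ) /
             (((⌈α⌉₊ - j - ℓ).factorial : ℝ) * ((m + ℓ).factorial : ℝ)) * Btil σ (ℓ + m))

/-- clipping to norm at most `C`. -/
def clip {E : Type*} [NormedAddCommGroup E] [NormedSpace ℝ E] (C : ℝ) (x : E) : E :=
  (max 1 (‖x‖ / C))⁻¹ • x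

/-- DP-SGD one-step mean for an index batch `b`. -/
def muStep {X : Type*} {p n : ℕ} (C η : ℝ) (k : ℕ)
    (g : EuclideanSpace ℝ (Fin p) → X → EuclideanSpace ℝ (Fin p))
    (θ : EuclideanSpace ℝ (Fin p)) (b : Finset (Fin n)) (D : Fin n → X) :
    EuclideanSpace ℝ (Fin p) :=
  θ - (η / (k : ℝ)) • ∑ i ∈ b, clip C (g θ (D i))

/-- fixed-size without-replacement DP-SGD transition density. -/
def pFSwoR {X : Type*} {p : ℕ} (C η σ : ℝ) (k : ℕ)
    (g : EuclideanSpace ℝ (Fin p) → X → EuclideanSpace ℝ (Fin p))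
    (n : ℕ) (D : Fin n → X) (θ θ' : EuclideanSpace ℝ (Fin p)) : ℝ :=
  ((n.choose k : ℝ))⁻¹ *
    ∑ b ∈ Finset.powersetCard k (Finset.univ : Finset (Fin n)),
      gaussND (muStep C η k g θ b D) (C * η * σ / (k : ℝ)) θ'

/-- fixed-size with-replacement DP-SGD transition density. -/
def pFSwR {X : Type*} {p : ℕ} (C η σ : ℝ) (k : ℕ)
    (g : EuclideanSpace ℝ (Fin p) → X → EuclideanSpace ℝ (Fin p))
    (n : ℕ) (D : Fin n → X) (θ θ' : EuclideanSpace ℝ (Fin p)) : ℝ :=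
  (((n : ℝ)) ^ k)⁻¹ *
    ∑ b : Fin k → Fin n,
      gaussND (θ - (η / (k : ℝ)) • ∑ j : Fin k, clip C (g θ (D (b j))))
        (C * η * σ / (k : ℝ)) θ'

/-- Poisson-subsampled DP-SGD transition density with sampling probability `k/n`. -/
def pPoisson {X : Type*} {p : ℕ} (C η σ : ℝ) (k : ℕ)
    (g : EuclideanSpace ℝ (Fin p) → X → EuclideanSpace ℝ (Fin p))
    (n : ℕ) (D : Fin n → X) (θ θ' : EuclideanSpace ℝ (Fin p)) : ℝ :=
  ∑ S : Finset (Fin n),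
    ((k : ℝ) / n) ^ S.card * (1 - (k : ℝ) / n) ^ (n - S.card) *
      gaussND (muStep C η k g θ S D) (C * η * σ / (k : ℝ)) θ'

/-- removing the `i`-th entry of a tuple. -/
def removeIdx {X : Type*} {n : ℕ} (i : Fin (n + 1)) (D : Fin (n + 1) → X) : Fin n → X :=
  fun j => D (i.succAbove j)

/-- `D'` is obtained from `D` by removing one element. -/
def IsRemoveOne {X : Type*} {m n : ℕ} (D : Fin m → X) (D' : Fin n → X) : Prop :=
  ∃ (h : n + 1 = m) (i : Fin (n + 1)), D' = removeIdx i (fun j => D (Fin.cast h j))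

/-- add/remove adjacency. -/
def AdjAddRemove {X : Type*} {m n : ℕ} (D : Fin m → X) (D' : Fin n → X) : Prop :=
  IsRemoveOne D D' ∨ IsRemoveOne D' D

/-- replace-one adjacency: the datasets differ in exactly one coordinate. -/
def AdjReplaceOne {X : Type*} {n : ℕ} (D D' : Fin n → X) : Prop :=
  ∃ i : Fin n, D i ≠ D' i ∧ ∀ j : Fin n, j ≠ i → D j = D' j

/-- joint density of the `T`-step Markov chain (coordinates `Θ_1,…,Θ_T`),
started at the deterministic point `θ₀`, with transition densities `ptrans t`. -/
def chainDensity {E : Type*} (T : ℕ) (ptrans : ℕ → E → E → ℝ) (θ₀ : E)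
    (x : Fin T → E) : ℝ :=
  ∏ t : Fin T,
    ptrans t
      (if 0 < (t : ℕ) then
        x ⟨(t : ℕ) - 1, Nat.lt_of_le_of_lt (Nat.sub_le _ _) t.isLt⟩
      else θ₀)
      (x t)

theorem nonneg_of_hasDerivAt_nonneg {b : ℝ} {F F' : ℝ → ℝ}
    (hF : ∀ x ∈ Set.Icc 0 b, HasDerivAt F (F' x) x) (h0 : 0 ≤ F 0)
    (hF' : ∀ x ∈ Set.Icc 0 b, 0 ≤ F' x) : ∀ x ∈ Set.Icc 0 b, 0 ≤ F x := by
  intro x hx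
  have hmono : MonotoneOn F (Set.Icc 0 b) := by
    refine monotoneOn_of_deriv_nonneg (convex_Icc 0 b)
      (fun y hy => (hF y hy).continuousAt.continuousWithinAt)
      (fun y hy => (hF y (interior_subset hy)).differentiableAt.differentiableWithinAt)
      (fun y hy => ?_)
    rw [(hF y (interior_subset hy)).deriv]
    exact hF' y (interior_subset hy)
  exact h0.trans (hmono ⟨le_rfl, hx.1.trans hx.2⟩ hx hx.1)

/-- Third order Taylor bound for `(1 + ε s) ^ α` whose remainder `P₀` is specified through a
pointwise bound `P₃` on the third derivative. -/
theorem one_add_mul_rpow_le {α ε b : ℝ} (hε : ε ^ 2 = 1) {P₀ P₁ P₂ P₃ : ℝ → ℝ}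
    (hpos : ∀ s ∈ Set.Icc 0 b, 0 < 1 + ε * s)
    (h₀ : ∀ s, HasDerivAt P₀ (P₁ s) s) (h₁ : ∀ s, HasDerivAt P₁ (P₂ s) s)
    (h₂ : ∀ s, HasDerivAt P₂ (P₃ s) s) (z₀ : P₀ 0 = 0) (z₁ : P₁ 0 = 0) (z₂ : P₂ 0 = 0)
    (hP : ∀ s ∈ Set.Icc 0 b, ε * (α * (α - 1) * (α - 2)) * (1 + ε * s) ^ (α - 3) ≤ P₃ s) :
    ∀ s ∈ Set.Icc 0 b,
      (1 + ε * s) ^ α ≤ 1 + α * (ε * s) + α * (α - 1) / 2 * s ^ 2 + P₀ s := by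
  have hr : ∀ r : ℝ, ∀ s ∈ Set.Icc 0 b,
      HasDerivAt (fun s : ℝ => (1 + ε * s) ^ r) (ε * r * (1 + ε * s) ^ (r - 1)) s := by
    intro r s hs
    have h : HasDerivAt (fun s : ℝ => 1 + ε * s) ε s := by
      simpa using ((hasDerivAt_id s).const_mul ε).const_add 1
    exact h.rpow_const (Or.inl (hpos s hs).ne')
  have hid : ∀ s : ℝ, HasDerivAt (fun s : ℝ => s) 1 s := hasDerivAt_id
  have c2 := nonneg_of_hasDerivAt_nonneg (b := b)
    (F := fun s => α * (α - 1) + P₂ s - α * (α - 1) * (1 + ε * s) ^ (α - 2))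
    (F' := fun s => P₃ s - ε * (α * (α - 1) * (α - 2)) * (1 + ε * s) ^ (α - 3))
    (fun s hs => by
      convert! ((h₂ s).const_add (α * (α - 1))).sub ((hr (α - 2) s hs).const_mul (α * (α - 1)))
        using 1
      rw [show α - 2 - 1 = α - 3 by ring]; ring)
    (by simp [z₂]) (fun s hs => by linarith [hP s hs])
  have c1 := nonneg_of_hasDerivAt_nonneg (b := b)
    (F := fun s => ε * α + α * (α - 1) * s + P₁ s - ε * α * (1 + ε * s) ^ (α - 1))
    (F' := fun s => α * (α - 1) + P₂ s - α * (α - 1) * (1 + ε * s) ^ (α - 2))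
    (fun s hs => by
      convert! ((((hid s).const_mul (α * (α - 1))).const_add (ε * α)).add (h₁ s)).sub
        ((hr (α - 1) s hs).const_mul (ε * α)) using 1
      rw [show α - 1 - 1 = α - 2 by ring]
      linear_combination (α * (α - 1) * (1 + ε * s) ^ (α - 2)) * hε)
    (by simp [z₁]) c2
  have c0 := nonneg_of_hasDerivAt_nonneg (b := b)
    (F := fun s => 1 + α * (ε * s) + α * (α - 1) / 2 * s ^ 2 + P₀ s - (1 + ε * s) ^ α)
    (F' := fun s => ε * α + α * (α - 1) * s + P₁ s - ε * α * (1 + ε * s) ^ (α - 1))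
    (fun s hs => by
      convert! ((((((hid s).const_mul ε).const_mul α).const_add 1).add
        (((hid s).pow 2).const_mul (α * (α - 1) / 2))).add (h₀ s)).sub (hr α s hs) using 1
      simp; ring)
    (by simp [z₀]) c1
  intro s hs
  linarith [c0 s hs]

/-- The `i`-fold antiderivative of `(1 + y) ^ m` vanishing to order `i` at `0`. -/
def binomAntideriv (m i : ℕ) (y : ℝ) : ℝ :=
  ∑ ℓ ∈ Finset.range (m + 1),
    (m.factorial : ℝ) / (((m - ℓ).factorial : ℝ) * ((i + ℓ).factorial : ℝ)) * y ^ (ℓ + i)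

theorem hasDerivAt_binomAntideriv (m i : ℕ) (y : ℝ) :
    HasDerivAt (binomAntideriv m (i + 1)) (binomAntideriv m i y) y := by
  unfold binomAntideriv
  refine HasDerivAt.fun_sum fun ℓ _ => ?_
  convert! (hasDerivAt_pow (ℓ + (i + 1)) y).const_mul
    ((m.factorial : ℝ) / (((m - ℓ).factorial : ℝ) * ((i + 1 + ℓ).factorial : ℝ))) using 1
  rw [show i + 1 + ℓ = (i + ℓ) + 1 by ring, Nat.factorial_succ,
    show ℓ + (i + 1) - 1 = ℓ + i by omega]
  push_cast
  have h1 : ((m - ℓ).factorial : ℝ) ≠ 0 := by positivity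
  have h2 : ((i + ℓ).factorial : ℝ) ≠ 0 := by positivity
  have h3 : (i + ℓ + 1 : ℝ) ≠ 0 := by positivity
  field_simp
  ring

theorem binomAntideriv_succ_zero (m i : ℕ) : binomAntideriv m (i + 1) 0 = 0 := by
  simp [binomAntideriv]

theorem binomAntideriv_zero (m : ℕ) (y : ℝ) : binomAntideriv m 0 y = (1 + y) ^ m := by
  rw [add_comm, add_pow]
  refine Finset.sum_congr rfl fun ℓ hℓ => ?_
  have : ℓ ≤ m := Nat.lt_succ_iff.mp (Finset.mem_range.mp hℓ)
  rw [Nat.cast_choose ℝ this]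
  simp
  ring

/-- The pointwise version of `Rtil3`, for a likelihood ratio deviating from `1` by `z`. -/
def taylorRem3 (α q z : ℝ) : ℝ :=
  if 3 < α then
    q ^ 3 * α * (α - 1) * |α - 2| *
      ((∑ ℓ ∈ Finset.range (⌈α⌉₊ - 3 + 1),
          q ^ ℓ * ((⌈α⌉₊ - 3).factorial : ℝ) /
            (((⌈α⌉₊ - 3 - ℓ).factorial : ℝ) * ((3 + ℓ).factorial : ℝ)) * |z| ^ (ℓ + 3)) +
        1 / 6 * |z| ^ 3)
  else
    q ^ 3 * α * (α - 1) * |α - 2| * (1 / 6 * (1 - q) ^ (α - 3) * |z| ^ 3)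

theorem one_add_mul_rpow_le_cubic {α ε b K : ℝ} (hε : ε ^ 2 = 1)
    (hpos : ∀ s ∈ Set.Icc 0 b, 0 < 1 + ε * s)
    (hK : ∀ s ∈ Set.Icc 0 b, ε * (α * (α - 1) * (α - 2)) * (1 + ε * s) ^ (α - 3) ≤ K) :
    ∀ s ∈ Set.Icc 0 b,
      (1 + ε * s) ^ α ≤ 1 + α * (ε * s) + α * (α - 1) / 2 * s ^ 2 + K / 6 * s ^ 3 := by
  have hid : ∀ s : ℝ, HasDerivAt (fun s : ℝ => s) 1 s := hasDerivAt_id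
  refine one_add_mul_rpow_le (P₀ := fun s => K / 6 * s ^ 3) (P₁ := fun s => K / 2 * s ^ 2)
    (P₂ := fun s => K * s) (P₃ := fun _ => K) hε hpos ?_ ?_ ?_ (by simp) (by simp) (by simp) hK
  · intro s
    convert! ((hid s).pow 3).const_mul (K / 6) using 1
    simp; ring
  · intro s
    convert! ((hid s).pow 2).const_mul (K / 2) using 1
    simp; ring
  · intro s
    simpa using (hid s).const_mul K

theorem one_add_mul_rpow_le_taylorRem3 {α q z : ℝ} (hα : 1 < α) (hq0 : 0 ≤ q) (hq1 : q < 1)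
    (hz : -1 ≤ z) :
    (1 + q * z) ^ α ≤
      1 + α * q * z + q ^ 2 / 2 * (α * (α - 1)) * z ^ 2 + taylorRem3 α q z := by
  have hA : 0 < α * (α - 1) := mul_pos (by linarith) (by linarith)
  rcases le_total 0 z with h0 | h0
  · have hy : 0 ≤ q * z := mul_nonneg hq0 h0
    have hpos : ∀ s ∈ Set.Icc 0 (q * z), 0 < 1 + 1 * s := fun s hs => by linarith [hs.1]
    have hmem : q * z ∈ Set.Icc 0 (q * z) := ⟨hy, le_rfl⟩
    unfold taylorRem3
    split_ifs with h3
    · have hc : (3 : ℝ) ≤ ⌈α⌉₊ := h3.le.trans (Nat.le_ceil α)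
      have hc' : 3 ≤ ⌈α⌉₊ := by exact_mod_cast hc
      set m := ⌈α⌉₊ - 3 with hm
      have hcast : (m : ℝ) = ⌈α⌉₊ - 3 := by rw [hm, Nat.cast_sub hc']; norm_num
      have hK : 0 ≤ α * (α - 1) * (α - 2) := mul_nonneg hA.le (by linarith)
      have key := one_add_mul_rpow_le (α := α) (ε := 1) (b := q * z)
        (P₀ := fun s => α * (α - 1) * (α - 2) * binomAntideriv m 3 s)
        (P₁ := fun s => α * (α - 1) * (α - 2) * binomAntideriv m 2 s)
        (P₂ := fun s => α * (α - 1) * (α - 2) * binomAntideriv m 1 s)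
        (P₃ := fun s => α * (α - 1) * (α - 2) * binomAntideriv m 0 s) (by norm_num) hpos
        (fun s => (hasDerivAt_binomAntideriv m 2 s).const_mul _)
        (fun s => (hasDerivAt_binomAntideriv m 1 s).const_mul _)
        (fun s => (hasDerivAt_binomAntideriv m 0 s).const_mul _)
        (by simp [binomAntideriv_succ_zero]) (by simp [binomAntideriv_succ_zero])
        (by simp [binomAntideriv_succ_zero])
        (fun s hs => by
          rw [binomAntideriv_zero, one_mul, one_mul, ← Real.rpow_natCast]
          refine mul_le_mul_of_nonneg_left ?_ hK
          exact Real.rpow_le_rpow_of_exponent_le (by linarith [hs.1])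
            (by rw [hcast]; linarith [Nat.le_ceil α]))
        (q * z) hmem
      rw [one_mul] at key
      rw [abs_of_nonneg h0, abs_of_nonneg (by linarith : 0 ≤ α - 2)]
      have hsum : binomAntideriv m 3 (q * z) = q ^ 3 * ∑ ℓ ∈ Finset.range (m + 1),
          q ^ ℓ * (m.factorial : ℝ) /
            (((m - ℓ).factorial : ℝ) * ((3 + ℓ).factorial : ℝ)) * z ^ (ℓ + 3) := by
        rw [binomAntideriv, Finset.mul_sum]
        refine Finset.sum_congr rfl fun ℓ _ => ?_
        rw [mul_pow, pow_add q]; ring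
      rw [hsum] at key
      have hextra : 0 ≤ q ^ 3 * α * (α - 1) * (α - 2) * (1 / 6 * z ^ 3) := by
        have : 0 ≤ α - 1 := by linarith
        have : 0 ≤ α - 2 := by linarith
        positivity
      nlinarith [key, hextra]
    · have key := one_add_mul_rpow_le_cubic (α := α) (ε := 1)
        (K := α * (α - 1) * |α - 2| * (1 - q) ^ (α - 3)) (by norm_num) hpos
        (fun s hs => by
          have h1 : (1 + 1 * s) ^ (α - 3) ≤ 1 :=
            Real.rpow_le_one_of_one_le_of_nonpos (by linarith [hs.1]) (by linarith)
          have h2 : 1 ≤ (1 - q) ^ (α - 3) :=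
            Real.one_le_rpow_of_pos_of_le_one_of_nonpos (by linarith) (by linarith) (by linarith)
          have h3 : 0 ≤ (1 + 1 * s) ^ (α - 3) := Real.rpow_nonneg (hpos s hs).le _
          calc 1 * (α * (α - 1) * (α - 2)) * (1 + 1 * s) ^ (α - 3)
              ≤ α * (α - 1) * |α - 2| * (1 + 1 * s) ^ (α - 3) := by
                rw [one_mul]; gcongr; exact le_abs_self _
            _ ≤ _ := mul_le_mul_of_nonneg_left (h1.trans h2) (by positivity))
        (q * z) hmem
      rw [abs_of_nonneg h0]
      rw [one_mul] at key
      linarith [key]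
  · have hy : 0 ≤ q * -z := mul_nonneg hq0 (by linarith)
    have hle : q * -z ≤ q := by nlinarith
    have hpos : ∀ s ∈ Set.Icc 0 (q * -z), 0 < 1 + (-1) * s := fun s hs => by linarith [hs.2]
    have hmem : q * -z ∈ Set.Icc 0 (q * -z) := ⟨hy, le_rfl⟩
    have habs : ∀ s ∈ Set.Icc 0 (q * -z), (-1) * (α * (α - 1) * (α - 2)) *
        (1 + (-1) * s) ^ (α - 3) ≤ α * (α - 1) * |α - 2| * (1 + (-1) * s) ^ (α - 3) := by
      intro s hs
      have h3 : 0 ≤ (1 + (-1) * s) ^ (α - 3) := Real.rpow_nonneg (hpos s hs).le _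
      refine mul_le_mul_of_nonneg_right ?_ h3
      nlinarith [neg_abs_le (α - 2)]
    unfold taylorRem3
    split_ifs with h3
    · have key := one_add_mul_rpow_le_cubic (α := α) (ε := -1)
        (K := α * (α - 1) * |α - 2|) (by norm_num) hpos
        (fun s hs => by
          refine (habs s hs).trans (mul_le_of_le_one_right (by positivity) ?_)
          exact Real.rpow_le_one (hpos s hs).le (by linarith [hs.1]) (by linarith))
        (q * -z) hmem
      have hextra : 0 ≤ q ^ 3 * α * (α - 1) * |α - 2| *
          ∑ ℓ ∈ Finset.range (⌈α⌉₊ - 3 + 1), q ^ ℓ * ((⌈α⌉₊ - 3).factorial : ℝ) /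
            (((⌈α⌉₊ - 3 - ℓ).factorial : ℝ) * ((3 + ℓ).factorial : ℝ)) * |z| ^ (ℓ + 3) := by
        have : 0 ≤ α - 1 := by linarith
        positivity
      rw [show 1 + -1 * (q * -z) = 1 + q * z by ring] at key
      have hz3 : |z| ^ 3 = (-z) ^ 3 := by rw [abs_of_nonpos h0]
      rw [mul_add, hz3]
      linarith [key, hextra]
    · have key := one_add_mul_rpow_le_cubic (α := α) (ε := -1)
        (K := α * (α - 1) * |α - 2| * (1 - q) ^ (α - 3)) (by norm_num) hpos
        (fun s hs => by
          refine (habs s hs).trans (mul_le_mul_of_nonneg_left ?_ (by positivity))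
          exact Real.rpow_le_rpow_of_nonpos (by linarith) (by linarith [hs.2]) (by linarith))
        (q * -z) hmem
      rw [show 1 + -1 * (q * -z) = 1 + q * z by ring] at key
      rw [abs_of_nonpos h0]
      linarith [key]

theorem sinh_mul_sinh_le {c d x y : ℝ} (hd : 0 < d) (hdc : d ≤ c) (hy : 0 < y) (hyx : y ≤ x) :
    Real.sinh (c * y) * Real.sinh (d * x) ≤ Real.sinh (c * x) * Real.sinh (d * y) := by
  have hc : 0 < c := hd.trans_le hdc
  have hs : ∀ e : ℝ, ∀ z, HasDerivAt (fun z => Real.sinh (e * z)) (e * Real.cosh (e * z)) z := by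
    intro e z
    convert! ((hasDerivAt_id z).const_mul e).sinh using 1
    simp; ring
  have hch : ∀ e : ℝ, ∀ z, HasDerivAt (fun z => Real.cosh (e * z)) (e * Real.sinh (e * z)) z := by
    intro e z
    convert! ((hasDerivAt_id z).const_mul e).cosh using 1
    simp; ring
  have hN := nonneg_of_hasDerivAt_nonneg (b := x)
    (F := fun z => c * Real.cosh (c * z) * Real.sinh (d * z)
      - Real.sinh (c * z) * (d * Real.cosh (d * z)))
    (F' := fun z => (c ^ 2 - d ^ 2) * (Real.sinh (c * z) * Real.sinh (d * z)))
    (fun z _ => by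
      convert! (((hch c z).const_mul c).mul (hs d z)).sub
        ((hs c z).mul ((hch d z).const_mul d)) using 1
      ring)
    (by simp)
    (fun z hz => by
      have h1 : 0 ≤ Real.sinh (c * z) := Real.sinh_nonneg_iff.2 (mul_nonneg hc.le hz.1)
      have h2 : 0 ≤ Real.sinh (d * z) := Real.sinh_nonneg_iff.2 (mul_nonneg hd.le hz.1)
      have h3 : 0 ≤ c ^ 2 - d ^ 2 := by nlinarith
      positivity)
  have hpos : ∀ z, 0 < z → 0 < Real.sinh (d * z) :=
    fun z hz => Real.sinh_pos_iff.2 (mul_pos hd hz)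
  have hder : ∀ z, 0 < z → HasDerivAt (fun z => Real.sinh (c * z) / Real.sinh (d * z))
      ((c * Real.cosh (c * z) * Real.sinh (d * z)
        - Real.sinh (c * z) * (d * Real.cosh (d * z))) / Real.sinh (d * z) ^ 2) z :=
    fun z hz => (hs c z).div (hs d z) (hpos z hz).ne'
  have hmono : MonotoneOn (fun z => Real.sinh (c * z) / Real.sinh (d * z)) (Set.Icc y x) := by
    refine monotoneOn_of_deriv_nonneg (convex_Icc y x)
      (fun z hz => (hder z (hy.trans_le hz.1)).continuousAt.continuousWithinAt)
      (fun z hz => ?_) (fun z hz => ?_)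
    · exact (hder z (hy.trans_le (interior_subset hz).1)).differentiableAt.differentiableWithinAt
    · have hz' := interior_subset hz
      rw [(hder z (hy.trans_le hz'.1)).deriv]
      exact div_nonneg (hN z ⟨hy.le.trans hz'.1, hz'.2⟩) (sq_nonneg _)
  have h := hmono ⟨le_rfl, hyx⟩ ⟨hyx, le_rfl⟩ hyx
  exact (div_le_div_iff₀ (hpos y hy) (hpos x (hy.trans_le hyx))).1 h

theorem rpow_sub_rpow_mul_le {α t u : ℝ} (hα : 1 < α) (ht : 1 < t) (htu : t ≤ u) :
    (t ^ α - t ^ (1 - α)) * (u - 1) ≤ (u ^ α - u ^ (1 - α)) * (t - 1) := by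
  have ht0 : 0 < t := by linarith
  have hu0 : 0 < u := by linarith
  obtain ⟨y, rfl⟩ : ∃ y, t = Real.exp y := ⟨Real.log t, (Real.exp_log ht0).symm⟩
  obtain ⟨x, rfl⟩ : ∃ x, u = Real.exp x := ⟨Real.log u, (Real.exp_log hu0).symm⟩
  have hy : 0 < y := Real.one_lt_exp_iff.1 ht
  have hyx : y ≤ x := Real.exp_le_exp.1 htu
  have h1 : ∀ z : ℝ, Real.exp z ^ α - Real.exp z ^ (1 - α)
      = 2 * Real.exp (z / 2) * Real.sinh ((α - 1 / 2) * z) := by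
    intro z
    rw [← Real.exp_mul, ← Real.exp_mul, Real.sinh_eq]
    rw [show 2 * Real.exp (z / 2) *
      ((Real.exp ((α - 1 / 2) * z) - Real.exp (-((α - 1 / 2) * z))) / 2)
      = Real.exp (z / 2) * Real.exp ((α - 1 / 2) * z)
        - Real.exp (z / 2) * Real.exp (-((α - 1 / 2) * z)) by ring, ← Real.exp_add,
      ← Real.exp_add]
    ring_nf
  have h2 : ∀ z : ℝ, Real.exp z - 1 = 2 * Real.exp (z / 2) * Real.sinh (1 / 2 * z) := by
    intro z
    rw [Real.sinh_eq]
    rw [show 2 * Real.exp (z / 2) *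
      ((Real.exp (1 / 2 * z) - Real.exp (-(1 / 2 * z))) / 2)
      = Real.exp (z / 2) * Real.exp (1 / 2 * z)
        - Real.exp (z / 2) * Real.exp (-(1 / 2 * z)) by ring, ← Real.exp_add,
      ← Real.exp_add]
    ring_nf
    simp; ring
  rw [h1, h1, h2, h2]
  have key := sinh_mul_sinh_le (c := α - 1 / 2) (d := 1 / 2) (by norm_num) (by linarith) hy hyx
  have hp : 0 ≤ 4 * (Real.exp (y / 2) * Real.exp (x / 2)) := by positivity
  have := mul_le_mul_of_nonneg_left key hp
  linarith

theorem mix_rpow_pair_le_of_one_le {α q w : ℝ} (hα : 1 < α) (hq0 : 0 ≤ q) (hq1 : q < 1)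
    (hw : 1 ≤ w) :
    (1 - q + q * w) ^ (1 - α) + w * (1 - q + q * w⁻¹) ^ (1 - α) ≤
      (1 - q + q * w) ^ α + w * (1 - q + q * w⁻¹) ^ α := by
  rcases hq0.eq_or_lt with rfl | hq
  · simp
  rcases hw.eq_or_lt with rfl | hw
  · simp
  have hw0 : 0 < w := by linarith
  have hwi : w⁻¹ < 1 := inv_lt_one_of_one_lt₀ hw
  have hwi0 : 0 < w⁻¹ := inv_pos.2 hw0
  set u := 1 - q + q * w with hu
  set v := 1 - q + q * w⁻¹ with hv
  have hv0 : 0 < v := by have := mul_pos hq hwi0; linarith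
  have hv1 : v < 1 := by nlinarith
  have huv : 1 ≤ u * v := by
    have hww : w * w⁻¹ = 1 := mul_inv_cancel₀ hw0.ne'
    have h2 : 2 ≤ w + w⁻¹ := by nlinarith [sq_nonneg (w - 1)]
    have : u * v = 1 + q * (1 - q) * (w + w⁻¹ - 2) := by
      rw [hu, hv]; linear_combination q ^ 2 * hww
    rw [this]
    have : 0 ≤ q * (1 - q) * (w + w⁻¹ - 2) :=
      mul_nonneg (mul_nonneg hq.le (by linarith)) (by linarith)
    linarith
  have hle : v⁻¹ ≤ u := by rw [inv_le_iff_one_le_mul₀ hv0]; exact huv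
  have key := rpow_sub_rpow_mul_le hα (one_lt_inv_iff₀.2 ⟨hv0, hv1⟩) hle
  have e1 : v⁻¹ ^ α = v⁻¹ * v ^ (1 - α) := by
    rw [Real.inv_rpow hv0.le, ← Real.rpow_neg hv0.le, ← Real.rpow_neg_one,
      ← Real.rpow_add hv0]; ring_nf
  have e2 : v⁻¹ ^ (1 - α) = v⁻¹ * v ^ α := by
    rw [Real.inv_rpow hv0.le, ← Real.rpow_neg hv0.le, ← Real.rpow_neg_one,
      ← Real.rpow_add hv0]; ring_nf
  have e3 : v⁻¹ - 1 = v⁻¹ * (1 - v) := by field_simp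
  rw [e1, e2, e3] at key
  have hvi : 0 < v⁻¹ := inv_pos.2 hv0
  have key2 : (v ^ (1 - α) - v ^ α) * (u - 1) ≤ (u ^ α - u ^ (1 - α)) * (1 - v) := by
    refine le_of_mul_le_mul_left ?_ hvi
    linarith
  have hu1 : u - 1 = w * (1 - v) := by
    rw [hu, hv]; field_simp; ring
  rw [hu1] at key2
  have h1v : 0 < 1 - v := by linarith
  have : w * (v ^ (1 - α) - v ^ α) ≤ u ^ α - u ^ (1 - α) := by
    refine le_of_mul_le_mul_right ?_ h1v
    linarith
  linarith

theorem mix_rpow_pair_le {α q w : ℝ} (hα : 1 < α) (hq0 : 0 ≤ q) (hq1 : q < 1) (hw : 0 < w) :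
    (1 - q + q * w) ^ (1 - α) + w * (1 - q + q * w⁻¹) ^ (1 - α) ≤
      (1 - q + q * w) ^ α + w * (1 - q + q * w⁻¹) ^ α := by
  rcases le_total 1 w with h | h
  · exact mix_rpow_pair_le_of_one_le hα hq0 hq1 h
  · have key := mul_le_mul_of_nonneg_left
      (mix_rpow_pair_le_of_one_le hα hq0 hq1 ((one_le_inv₀ hw).2 h)) hw.le
    rw [inv_inv, mul_add, mul_add, ← mul_assoc, ← mul_assoc, mul_inv_cancel₀ hw.ne', one_mul,
      one_mul] at key
    linarith

/-- Rényi integrand of the mixture `(1 - q) b + q a` and `b`, symmetrised in `(a, b)`, dominates the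
same expression with the two arguments of the divergence exchanged. -/
theorem mix_div_rpow_pair_le {α q a b : ℝ} (hα : 1 < α) (hq0 : 0 ≤ q) (hq1 : q < 1)
    (ha : 0 < a) (hb : 0 < b) :
    (b / ((1 - q) * b + q * a)) ^ α * ((1 - q) * b + q * a) +
        (a / ((1 - q) * a + q * b)) ^ α * ((1 - q) * a + q * b) ≤
      (((1 - q) * b + q * a) / b) ^ α * b + (((1 - q) * a + q * b) / a) ^ α * a := by
  have key := mul_le_mul_of_nonneg_right (mix_rpow_pair_le hα hq0 hq1 (div_pos ha hb)) hb.le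
  have gen : ∀ a b : ℝ, 0 < a → 0 < b →
      (b / ((1 - q) * b + q * a)) ^ α * ((1 - q) * b + q * a)
        = (1 - q + q * (a / b)) ^ (1 - α) * b ∧
      (((1 - q) * b + q * a) / b) ^ α * b = (1 - q + q * (a / b)) ^ α * b := by
    intro a b ha hb
    have hU : (1 - q) * b + q * a = (1 - q + q * (a / b)) * b := by field_simp
    have hu : 0 < 1 - q + q * (a / b) := by
      have : 0 ≤ q * (a / b) := by positivity
      linarith
    refine ⟨?_, ?_⟩
    · rw [hU, div_mul_cancel_right₀ hb.ne', Real.inv_rpow hu.le, ← Real.rpow_neg hu.le,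
        ← mul_assoc, ← Real.rpow_add_one hu.ne']
      ring_nf
    · rw [hU, mul_div_cancel_right₀ _ hb.ne']
  rw [(gen a b ha hb).1, (gen a b ha hb).2, (gen b a hb ha).1, (gen b a hb ha).2]
  rw [inv_div] at key
  have hab : a / b * b = a := div_mul_cancel₀ _ hb.ne'
  have e : ∀ r : ℝ, a / b * r * b = r * a := fun r => by rw [mul_right_comm, hab, mul_comm]
  rw [add_mul, add_mul, e, e] at key
  exact key

open ProbabilityTheory in
theorem memLp_exp_sub_gaussianReal (v : NNReal) (p : NNReal) :
    MemLp (fun y : ℝ => Real.exp (y - v / 2)) p (gaussianReal 0 v) := by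
  rcases eq_or_ne p 0 with rfl | hp
  · simpa using (by fun_prop : Continuous fun y : ℝ => Real.exp (y - v / 2)).aestronglyMeasurable
  rw [← integrable_norm_rpow_iff (by fun_prop) (by simpa using hp) (by simp)]
  convert (integrable_exp_mul_gaussianReal (μ := 0) (v := v) (p : ℝ)).const_mul
    (Real.exp (-(p * (v / 2)))) using 2 with y
  rw [Real.norm_eq_abs, Real.abs_exp, ← Real.exp_mul, ← Real.exp_add]
  congr 1
  simp
  ring

open ProbabilityTheory in
theorem integral_exp_sub_gaussianReal (v : NNReal) :
    ∫ y, Real.exp (y - v / 2) ∂gaussianReal 0 v = 1 := by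
  have h := congrFun (mgf_id_gaussianReal (μ := 0) (v := v)) 1
  simp only [mgf, id, one_mul, zero_add, one_pow, mul_one] at h
  simp_rw [Real.exp_sub, integral_div, h]
  exact div_self (Real.exp_pos _).ne'

/-- The moment `E[(1 - q + q W) ^ α]` where `W` is the likelihood ratio of two Gaussians whose means
are at squared distance `v` in units of the standard deviation. -/
def mixMoment (α : ℝ) (v : NNReal) (q : ℝ) : ℝ :=
  ∫ y, (1 - q + q * Real.exp (y - v / 2)) ^ α ∂ProbabilityTheory.gaussianReal 0 v

theorem mix_pos {q w : ℝ} (hq0 : 0 ≤ q) (hq1 : q < 1) (hw : 0 ≤ w) : 0 < 1 - q + q * w := by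
  have := mul_nonneg hq0 hw
  linarith

open ProbabilityTheory in
theorem integrable_mix_rpow {α a b : ℝ} (hα : 0 ≤ α) (ha : 0 ≤ a) (hb : 0 ≤ b) (v : NNReal) :
    Integrable (fun y => (a + b * Real.exp (y - v / 2)) ^ α) (gaussianReal 0 v) := by
  have h := ((memLp_const a).add
    ((memLp_exp_sub_gaussianReal v ⟨α, hα⟩).const_mul b)).integrable_norm_rpow'
  refine h.congr (Filter.Eventually.of_forall fun y => ?_)
  have : 0 ≤ a + b * Real.exp (y - v / 2) := by positivity
  have hα' : (ENNReal.ofNNReal ⟨α, hα⟩).toReal = α := rfl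
  simp [abs_of_nonneg this, hα']

open ProbabilityTheory in
theorem rpow_mix_le_integral {α a b : ℝ} (hα : 1 ≤ α) (ha : 0 ≤ a) (hb : 0 ≤ b) (v : NNReal) :
    (a + b) ^ α ≤ ∫ y, (a + b * Real.exp (y - v / 2)) ^ α ∂gaussianReal 0 v := by
  have hW : Integrable (fun y : ℝ => Real.exp (y - v / 2)) (gaussianReal 0 v) := by
    simpa using (memLp_exp_sub_gaussianReal v 1).integrable (by simp)
  have h := (convexOn_rpow hα).map_integral_le (μ := gaussianReal 0 v)
    (f := fun y => a + b * Real.exp (y - v / 2))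
    (fun x _ => (Real.continuousAt_rpow_const x α (Or.inr (by linarith))).continuousWithinAt)
    isClosed_Ici
    (Filter.Eventually.of_forall fun y => Set.mem_Ici.2 (by positivity))
    ((integrable_const a).add (hW.const_mul b)) (integrable_mix_rpow (by linarith) ha hb v)
  rw [integral_add (integrable_const a) (hW.const_mul b), integral_const_mul,
    integral_exp_sub_gaussianReal] at h
  simpa using h

open ProbabilityTheory in
theorem mixMoment_mono_var {α q : ℝ} (hα : 1 ≤ α) (hq0 : 0 ≤ q) (hq1 : q < 1) {v V : NNReal}
    (h : v ≤ V) : mixMoment α v q ≤ mixMoment α V q := by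
  obtain ⟨t, rfl⟩ := exists_add_of_le h
  have hα0 : 0 ≤ α := by linarith
  have hint := integrable_mix_rpow hα0 (by linarith : 0 ≤ 1 - q) hq0 (v + t)
  have hconv : (gaussianReal 0 v).conv (gaussianReal 0 t) = gaussianReal 0 (v + t) := by
    simpa using gaussianReal_conv_gaussianReal (m₁ := 0) (m₂ := 0) (v₁ := v) (v₂ := t)
  unfold mixMoment
  rw [← hconv] at hint ⊢
  rw [integral_conv hint]
  have hint2 := ((integrable_conv_iff hint.aestronglyMeasurable).1 hint).2
  refine integral_mono (integrable_mix_rpow hα0 (by linarith) hq0 v) ?_ fun x => ?_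
  · refine hint2.congr (Filter.Eventually.of_forall fun x => integral_congr_ae
      (Filter.Eventually.of_forall fun y => ?_))
    exact Real.norm_of_nonneg (Real.rpow_nonneg
      (mix_pos hq0 hq1 (Real.exp_pos _).le).le _)
  · have := rpow_mix_le_integral hα (by linarith : 0 ≤ 1 - q)
      (mul_nonneg hq0 (Real.exp_pos (x - v / 2)).le) t
    refine this.trans_eq (integral_congr_ae (Filter.Eventually.of_forall fun y => ?_))
    simp only
    rw [mul_assoc, ← Real.exp_add]
    push_cast
    ring_nf

open ProbabilityTheory in
theorem mixMoment_mono_rate {α p q : ℝ} (hα : 1 ≤ α) (hp0 : 0 ≤ p) (hpq : p ≤ q) (hq1 : q < 1)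
    (v : NNReal) : mixMoment α v p ≤ mixMoment α v q := by
  rcases (hp0.trans hpq).eq_or_lt with h0 | hq
  · rw [le_antisymm (hpq.trans h0.symm.le) hp0, ← h0]
  have hα0 : 0 ≤ α := by linarith
  have hone : 1 ≤ mixMoment α v q := by
    have := rpow_mix_le_integral hα (by linarith : 0 ≤ 1 - q) hq.le v
    simpa [mixMoment] using this
  have hint := integrable_mix_rpow hα0 (by linarith : 0 ≤ 1 - q) hq.le v
  have hl0 : 0 ≤ p / q := div_nonneg hp0 hq.le
  have hl1 : p / q ≤ 1 := (div_le_one hq).2 hpq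
  have hle : mixMoment α v p ≤ (1 - p / q) + p / q * mixMoment α v q := by
    unfold mixMoment
    rw [← integral_const_mul]
    have : (1 - p / q) = ∫ _, (1 - p / q) ∂gaussianReal 0 v := by simp
    rw [this, ← integral_add (integrable_const _) (hint.const_mul _)]
    refine integral_mono (integrable_mix_rpow hα0 (by linarith) hp0 v)
      ((integrable_const _).add (hint.const_mul _)) fun y => ?_
    have := (convexOn_rpow hα).2 (Set.mem_Ici.2 zero_le_one)
      (Set.mem_Ici.2 (mix_pos hq.le hq1 (Real.exp_pos (y - v / 2)).le).le)
      (sub_nonneg.2 hl1) hl0 (by ring)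
    simp only [smul_eq_mul, Real.one_rpow, mul_one] at this
    refine le_trans (le_of_eq ?_) this
    simp only
    congr 1
    field_simp
    ring
  nlinarith

open ProbabilityTheory in
theorem Mcoef_eq_integral {σ : ℝ} (hσ : 0 < σ) (V : NNReal) (hV : (V : ℝ) = 4 / σ ^ 2) (j : ℕ) :
    Mcoef σ j = ∫ y, (Real.exp (y - V / 2) - 1) ^ j ∂gaussianReal 0 V := by
  have hs : (0 : ℝ) < (σ / 2) ^ 2 := by positivity
  set s2 : NNReal := ⟨(σ / 2) ^ 2, hs.le⟩ with hs2
  have hs2c : (s2 : ℝ) = (σ / 2) ^ 2 := rfl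
  have hs2ne : s2 ≠ 0 := by
    rw [← NNReal.coe_ne_zero, hs2c]; exact hs.ne'
  have hmap : (gaussianReal 0 s2).map (fun x => (4 / σ ^ 2) * x) = gaussianReal 0 V := by
    rw [gaussianReal_map_const_mul]
    congr 1
    · simp
    · rw [← NNReal.coe_inj]
      rw [NNReal.coe_mul, hs2c, hV, NNReal.coe_mk]
      field_simp
      norm_num
  rw [← hmap, integral_map (by fun_prop) (by fun_prop),
    integral_gaussianReal_eq_integral_smul hs2ne]
  unfold Mcoef
  refine integral_congr_ae (Filter.Eventually.of_forall fun θ => ?_)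
  simp only [smul_eq_mul]
  rw [mul_comm]
  have hc : (0 : ℝ) < (2 * Real.pi * (σ / 2) ^ 2) ^ (-(1 : ℝ) / 2) := by positivity
  congr 1
  · rw [gaussianPDFReal_def]
    unfold gauss1
    rw [hs2c, neg_div, Real.rpow_neg (by positivity), Real.sqrt_eq_rpow]
  · congr 2
    unfold gauss1
    rw [mul_div_mul_left _ _ hc.ne', ← Real.exp_sub, hV]
    congr 1
    field_simp
    ring

open ProbabilityTheory in
theorem integrable_abs_exp_sub_one_pow (V : NNReal) (j : ℕ) :
    Integrable (fun y => |Real.exp (y - V / 2) - 1| ^ j) (gaussianReal 0 V) := by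
  have h := (memLp_exp_sub_gaussianReal V j).sub (memLp_const (1 : ℝ))
  simpa using h.integrable_norm_pow'

open ProbabilityTheory in
theorem integral_abs_pow_le_Btil {σ : ℝ} (hσ : 0 < σ) (V : NNReal) (hV : (V : ℝ) = 4 / σ ^ 2)
    (j : ℕ) : ∫ y, |Real.exp (y - V / 2) - 1| ^ j ∂gaussianReal 0 V ≤ Btil σ j := by
  unfold Btil
  split_ifs with hj
  · rw [Mcoef_eq_integral hσ V hV]
    simp_rw [hj.pow_abs]
    exact le_rfl
  · obtain ⟨i, rfl⟩ := Nat.not_even_iff_odd.1 hj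
    have hm : ∀ i : ℕ, MemLp (fun y => |Real.exp (y - V / 2) - 1| ^ i) (ENNReal.ofReal 2)
        (gaussianReal 0 V) := by
      intro i
      rw [show ENNReal.ofReal 2 = 2 by simp, memLp_two_iff_integrable_sq (by fun_prop)]
      simp_rw [← pow_mul]
      exact integrable_abs_exp_sub_one_pow V _
    have h := integral_mul_le_Lp_mul_Lq_of_nonneg (μ := gaussianReal 0 V)
      Real.HolderConjugate.two_two
      (f := fun y => |Real.exp (y - V / 2) - 1| ^ i)
      (g := fun y => |Real.exp (y - V / 2) - 1| ^ (i + 1))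
      (Filter.Eventually.of_forall fun y => by positivity)
      (Filter.Eventually.of_forall fun y => by positivity) (hm i) (hm (i + 1))
    have hsq : ∀ i : ℕ, ∫ y, (|Real.exp (y - V / 2) - 1| ^ i) ^ (2 : ℝ) ∂gaussianReal 0 V
        = Mcoef σ (2 * i) := by
      intro i
      rw [Mcoef_eq_integral hσ V hV]
      refine integral_congr_ae (Filter.Eventually.of_forall fun y => ?_)
      simp only
      rw [Real.rpow_two, ← pow_mul, mul_comm, (even_two_mul i).pow_abs]
    rw [hsq, hsq, ← Real.sqrt_eq_rpow, ← Real.sqrt_eq_rpow] at h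
    have hnn : 0 ≤ Mcoef σ (2 * i) := by
      rw [Mcoef_eq_integral hσ V hV]
      exact integral_nonneg fun y => (even_two_mul i).pow_nonneg _
    rw [show 2 * i + 1 - 1 = 2 * i by omega, show 2 * i + 1 + 1 = 2 * (i + 1) by ring,
      Real.sqrt_mul hnn]
    refine le_trans (le_of_eq ?_) h
    refine integral_congr_ae (Filter.Eventually.of_forall fun y => ?_)
    simp only
    rw [← pow_add]; ring_nf

theorem Btil_nonneg {σ : ℝ} (hσ : 0 < σ) (j : ℕ) : 0 ≤ Btil σ j := by
  have h4 : (0 : ℝ) ≤ 4 / σ ^ 2 := by positivity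
  exact (integral_nonneg fun y => by positivity).trans
    (integral_abs_pow_le_Btil hσ ⟨_, h4⟩ rfl j)

theorem Rtil3_nonneg {α σ q : ℝ} (hα : 1 < α) (hσ : 0 < σ) (hq0 : 0 ≤ q) (hq1 : q < 1) :
    0 ≤ Rtil3 α σ q := by
  have hB := Btil_nonneg hσ
  have h1 : 0 ≤ α - 1 := by linarith
  have h2 : 0 ≤ 1 - q := by linarith
  have hB3 := hB 3
  unfold Rtil3
  split_ifs
  · have : 0 ≤ ∑ ℓ ∈ Finset.range (⌈α⌉₊ - 3 + 1),
        q ^ ℓ * ((⌈α⌉₊ - 3).factorial : ℝ) /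
          (((⌈α⌉₊ - 3 - ℓ).factorial : ℝ) * ((3 + ℓ).factorial : ℝ)) * Btil σ (ℓ + 3) :=
      Finset.sum_nonneg fun ℓ _ => mul_nonneg (by positivity) (hB _)
    positivity
  · positivity

open ProbabilityTheory in
theorem integral_taylorRem3_le {α σ q : ℝ} (hα : 1 < α) (hσ : 0 < σ) (hq0 : 0 ≤ q) (hq1 : q < 1)
    (V : NNReal) (hV : (V : ℝ) = 4 / σ ^ 2) :
    Integrable (fun y => taylorRem3 α q (Real.exp (y - V / 2) - 1)) (gaussianReal 0 V) ∧
      ∫ y, taylorRem3 α q (Real.exp (y - V / 2) - 1) ∂gaussianReal 0 V ≤ Rtil3 α σ q := by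
  have hI := integrable_abs_exp_sub_one_pow V
  have hB := integral_abs_pow_le_Btil hσ V hV
  have h1 : 0 ≤ α - 1 := by linarith
  have h2 : 0 ≤ 1 - q := by linarith
  unfold taylorRem3 Rtil3
  split_ifs
  · have hs : Integrable (fun y => ∑ ℓ ∈ Finset.range (⌈α⌉₊ - 3 + 1),
        q ^ ℓ * ((⌈α⌉₊ - 3).factorial : ℝ) /
          (((⌈α⌉₊ - 3 - ℓ).factorial : ℝ) * ((3 + ℓ).factorial : ℝ)) *
            |Real.exp (y - V / 2) - 1| ^ (ℓ + 3)) (gaussianReal 0 V) :=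
      integrable_finsetSum _ fun ℓ _ => (hI _).const_mul _
    refine ⟨(hs.add ((hI 3).const_mul _)).const_mul _, ?_⟩
    rw [integral_const_mul, integral_add hs ((hI 3).const_mul _), integral_const_mul,
      integral_finsetSum _ fun ℓ _ => (hI _).const_mul _]
    simp_rw [integral_const_mul]
    gcongr with ℓ _
    · exact hB _
    · exact hB 3
  · refine ⟨((hI 3).const_mul _).const_mul _, ?_⟩
    rw [integral_const_mul, integral_const_mul]
    gcongr
    exact hB 3

open ProbabilityTheory in
theorem mixMoment_le {α σ q : ℝ} (hα : 1 < α) (hσ : 0 < σ) (hq0 : 0 ≤ q) (hq1 : q < 1)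
    (V : NNReal) (hV : (V : ℝ) = 4 / σ ^ 2) :
    mixMoment α V q ≤ 1 + q ^ 2 / 2 * (α * (α - 1)) * Mcoef σ 2 + Rtil3 α σ q := by
  obtain ⟨hRi, hR⟩ := integral_taylorRem3_le hα hσ hq0 hq1 V hV
  have hW : Integrable (fun y : ℝ => Real.exp (y - V / 2)) (gaussianReal 0 V) := by
    simpa using (memLp_exp_sub_gaussianReal V 1).integrable (by simp)
  have hz : Integrable (fun y : ℝ => Real.exp (y - V / 2) - 1) (gaussianReal 0 V) :=
    hW.sub (integrable_const 1)
  have hz2 : Integrable (fun y : ℝ => (Real.exp (y - V / 2) - 1) ^ 2) (gaussianReal 0 V) := by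
    simpa using integrable_abs_exp_sub_one_pow V 2
  have hz0 : ∫ y, (Real.exp (y - V / 2) - 1) ∂gaussianReal 0 V = 0 := by
    rw [integral_sub hW (integrable_const 1), integral_exp_sub_gaussianReal]; simp
  have hA : Integrable (fun y : ℝ => 1 + α * q * (Real.exp (y - V / 2) - 1)) (gaussianReal 0 V) :=
    (integrable_const 1).add (hz.const_mul _)
  have hA2 : Integrable (fun y : ℝ => (1 + α * q * (Real.exp (y - V / 2) - 1)) +
      q ^ 2 / 2 * (α * (α - 1)) * (Real.exp (y - V / 2) - 1) ^ 2) (gaussianReal 0 V) :=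
    hA.add (hz2.const_mul _)
  have hle : mixMoment α V q ≤ ∫ y, ((1 + α * q * (Real.exp (y - V / 2) - 1)) +
      q ^ 2 / 2 * (α * (α - 1)) * (Real.exp (y - V / 2) - 1) ^ 2 +
      taylorRem3 α q (Real.exp (y - V / 2) - 1)) ∂gaussianReal 0 V := by
    refine integral_mono (integrable_mix_rpow (by linarith) (by linarith) hq0 V)
      (hA2.add hRi) fun y => ?_
    have hp := Real.exp_pos (y - V / 2)
    have := one_add_mul_rpow_le_taylorRem3 hα hq0 hq1
      (by linarith : -1 ≤ Real.exp (y - V / 2) - 1)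
    rwa [show 1 + q * (Real.exp (y - V / 2) - 1) = 1 - q + q * Real.exp (y - V / 2) by ring]
      at this
  rw [integral_add hA2 hRi, integral_add hA (hz2.const_mul _),
    integral_add (integrable_const 1) (hz.const_mul _), integral_const_mul, integral_const_mul,
    hz0, ← Mcoef_eq_integral hσ V hV] at hle
  simp only [integral_const, probReal_univ, smul_eq_mul, mul_one, mul_zero, add_zero] at hle
  linarith

section GaussianComparison

open ProbabilityTheory

variable {p : ℕ}

theorem gaussND_pos (μ : EuclideanSpace ℝ (Fin p)) {s : ℝ} (hs : 0 < s)
    (x : EuclideanSpace ℝ (Fin p)) : 0 < gaussND μ s x := by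
  unfold gaussND
  positivity

theorem continuous_gaussND (μ : EuclideanSpace ℝ (Fin p)) (s : ℝ) : Continuous (gaussND μ s) := by
  unfold gaussND
  fun_prop

theorem gaussND_norm_const_mul (p : ℕ) {s : ℝ} (hs : 0 < s) :
    (2 * Real.pi * s ^ 2) ^ (-(p : ℝ) / 2) * (Real.pi / (1 / (2 * s ^ 2))) ^ ((p : ℝ) / 2) = 1 := by
  have h : Real.pi / (1 / (2 * s ^ 2)) = 2 * Real.pi * s ^ 2 := by field_simp
  rw [h, ← Real.rpow_add (by positivity), neg_div, neg_add_cancel, Real.rpow_zero]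

theorem integral_gaussND (μ : EuclideanSpace ℝ (Fin p)) {s : ℝ} (hs : 0 < s) :
    ∫ x, gaussND μ s x = 1 := by
  have h := GaussianFourier.integral_rexp_neg_mul_sq_norm (V := EuclideanSpace ℝ (Fin p))
    (b := 1 / (2 * s ^ 2)) (by positivity)
  rw [finrank_euclideanSpace_fin] at h
  have hshift := integral_sub_right_eq_self
    (fun v : EuclideanSpace ℝ (Fin p) => Real.exp (-(1 / (2 * s ^ 2)) * ‖v‖ ^ 2)) (μ := volume) μ
  rw [h] at hshift
  rw [← gaussND_norm_const_mul p hs, ← hshift, ← integral_const_mul]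
  refine integral_congr_ae (Filter.Eventually.of_forall fun x => ?_)
  simp only [gaussND]
  congr 2
  ring

theorem integrable_gaussND (μ : EuclideanSpace ℝ (Fin p)) {s : ℝ} (hs : 0 < s) :
    Integrable (gaussND μ s) :=
  Integrable.of_integral_ne_zero (by rw [integral_gaussND μ hs]; exact one_ne_zero)

theorem lintegral_gaussND (μ : EuclideanSpace ℝ (Fin p)) {s : ℝ} (hs : 0 < s) :
    ∫⁻ x, ENNReal.ofReal (gaussND μ s x) = 1 := by
  rw [← ofReal_integral_eq_lintegral_ofReal (integrable_gaussND μ hs)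
    (Filter.Eventually.of_forall fun x => (gaussND_pos μ hs x).le), integral_gaussND μ hs,
    ENNReal.ofReal_one]

/-- Under the Gaussian with mean `μ`, linear functionals are Gaussian. -/
theorem map_inner_gaussND (μ δ : EuclideanSpace ℝ (Fin p)) {s : ℝ} (hs : 0 < s) (v : NNReal)
    (hv : (v : ℝ) = ‖δ‖ ^ 2 / s ^ 2) :
    (volume.withDensity fun x => ENNReal.ofReal (gaussND μ s x)).map
      (fun x => inner ℝ δ (x - μ) / s ^ 2) = gaussianReal 0 v := by
  have hfin : IsFiniteMeasure (volume.withDensity fun x => ENNReal.ofReal (gaussND μ s x)) :=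
    isFiniteMeasure_withDensity (by rw [lintegral_gaussND μ hs]; simp)
  have hmeas : Measurable fun x : EuclideanSpace ℝ (Fin p) => ENNReal.ofReal (gaussND μ s x) :=
    (continuous_gaussND μ s).measurable.ennreal_ofReal
  refine Measure.ext_of_charFun (funext fun t => ?_)
  rw [charFun_gaussianReal, charFun_apply, integral_map (by fun_prop) (by fun_prop),
    integral_withDensity_eq_integral_toReal_smul hmeas (by simp)]
  have hb : 0 < ((1 / (2 * s ^ 2) : ℝ) : ℂ).re := by rw [Complex.ofReal_re]; positivity
  have h := GaussianFourier.integral_cexp_neg_mul_sq_norm_add (V := EuclideanSpace ℝ (Fin p)) hb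
    ((t / s ^ 2 : ℝ) * Complex.I) δ
  have hshift := integral_sub_right_eq_self (μ := volume)
    (fun v : EuclideanSpace ℝ (Fin p) => Complex.exp (-((1 / (2 * s ^ 2) : ℝ) : ℂ) * (‖v‖ : ℂ) ^ 2 +
      (t / s ^ 2 : ℝ) * Complex.I * (inner ℝ δ v : ℝ))) μ
  rw [h, finrank_euclideanSpace_fin] at hshift
  have hnc := congrArg (fun r : ℝ => (r : ℂ)) (gaussND_norm_const_mul p hs)
  simp only [Complex.ofReal_mul, Complex.ofReal_one] at hnc
  rw [Complex.ofReal_cpow (x := Real.pi / (1 / (2 * s ^ 2))) (by positivity)] at hnc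
  have hexp : Complex.exp ((((t / s ^ 2 : ℝ) : ℂ) * Complex.I) ^ 2 * (‖δ‖ : ℂ) ^ 2 /
      (4 * ((1 / (2 * s ^ 2) : ℝ) : ℂ))) =
      Complex.exp (t * (0 : ℝ) * Complex.I - (v : ℝ) * t ^ 2 / 2) := by
    congr 1
    have hsC : (s : ℂ) ≠ 0 := by exact_mod_cast hs.ne'
    rw [hv, mul_pow, Complex.I_sq]
    push_cast
    field_simp
    ring
  rw [← hexp]
  set c : ℂ := (((2 * Real.pi * s ^ 2) ^ (-(p : ℝ) / 2) : ℝ) : ℂ) with hc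
  have hmul := congrArg (fun z : ℂ => c * z) hshift
  beta_reduce at hmul
  rw [← integral_const_mul] at hmul
  refine Eq.trans ?_ (hmul.trans ?_)
  · refine integral_congr_ae (Filter.Eventually.of_forall fun x => ?_)
    simp only
    rw [ENNReal.toReal_ofReal (gaussND_pos μ hs x).le, Complex.real_smul, gaussND,
      Complex.ofReal_mul, Complex.ofReal_exp, mul_assoc, ← Complex.exp_add]
    congr 2
    simp
    ring
  · rw [← mul_assoc]
    conv_rhs => rw [← one_mul (Complex.exp _), ← hnc]
    congr 2
    push_cast
    ring_nf

theorem gaussND_div_gaussND (μ ν : EuclideanSpace ℝ (Fin p)) {s : ℝ} (hs : 0 < s)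
    (x : EuclideanSpace ℝ (Fin p)) :
    gaussND μ s x / gaussND ν s x =
      Real.exp (inner ℝ (μ - ν) (x - ν) / s ^ 2 - ‖μ - ν‖ ^ 2 / s ^ 2 / 2) := by
  unfold gaussND
  have hc : (0 : ℝ) < (2 * Real.pi * s ^ 2) ^ (-(p : ℝ) / 2) := by positivity
  rw [mul_div_mul_left _ _ hc.ne', ← Real.exp_sub]
  congr 1
  have h : ‖x - μ‖ ^ 2 = ‖x - ν‖ ^ 2 - 2 * inner ℝ (μ - ν) (x - ν) + ‖μ - ν‖ ^ 2 := by
    rw [show x - μ = (x - ν) - (μ - ν) by abel, norm_sub_sq_real, real_inner_comm]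
  rw [h]
  field_simp
  ring

/-- Rényi integrand of densities with values `a` and `b`. -/
def renyiInt (α a b : ℝ) : ℝ := (a / b) ^ α * b

theorem lintegral_renyiInt_mix_eq {α q : ℝ} (hα : 0 ≤ α) (hq0 : 0 ≤ q) (hq1 : q < 1)
    (μ ν : EuclideanSpace ℝ (Fin p)) {s : ℝ} (hs : 0 < s)
    (v : NNReal) (hv : (v : ℝ) = ‖μ - ν‖ ^ 2 / s ^ 2) :
    ∫⁻ x, ENNReal.ofReal (renyiInt α ((1 - q) * gaussND ν s x + q * gaussND μ s x)
      (gaussND ν s x)) = ENNReal.ofReal (mixMoment α v q) := by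
  have hnn : ∀ y : ℝ, 0 ≤ (1 - q + q * Real.exp (y - v / 2)) ^ α := fun y =>
    Real.rpow_nonneg (mix_pos hq0 hq1 (Real.exp_pos _).le).le _
  have hmF : Measurable fun y : ℝ =>
      ENNReal.ofReal ((1 - q + q * Real.exp (y - v / 2)) ^ α) := by fun_prop
  have hmN : Measurable fun x : EuclideanSpace ℝ (Fin p) => ENNReal.ofReal (gaussND ν s x) :=
    (continuous_gaussND ν s).measurable.ennreal_ofReal
  have hmL : Measurable fun x : EuclideanSpace ℝ (Fin p) => inner ℝ (μ - ν) (x - ν) / s ^ 2 :=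
    (by fun_prop : Continuous fun x : EuclideanSpace ℝ (Fin p) =>
      inner ℝ (μ - ν) (x - ν) / s ^ 2).measurable
  have hmFL : Measurable fun x : EuclideanSpace ℝ (Fin p) => ENNReal.ofReal
      ((1 - q + q * Real.exp (inner ℝ (μ - ν) (x - ν) / s ^ 2 - v / 2)) ^ α) := hmF.comp hmL
  unfold mixMoment
  rw [ofReal_integral_eq_lintegral_ofReal
    (integrable_mix_rpow hα (by linarith) hq0 v) (Filter.Eventually.of_forall hnn),
    ← map_inner_gaussND ν (μ - ν) hs v hv, lintegral_map hmF hmL,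
    lintegral_withDensity_eq_lintegral_mul _ hmN hmFL]
  refine lintegral_congr fun x => ?_
  have hb := gaussND_pos ν hs x
  have hdiv : ((1 - q) * gaussND ν s x + q * gaussND μ s x) / gaussND ν s x =
      1 - q + q * (gaussND μ s x / gaussND ν s x) := by field_simp
  rw [Pi.mul_apply, ← ENNReal.ofReal_mul hb.le, mul_comm (gaussND ν s x), renyiInt, hv, hdiv,
    gaussND_div_gaussND μ ν hs]

theorem lintegral_renyiInt_mix_le {α q : ℝ} (hα : 1 < α) (hq0 : 0 ≤ q) (hq1 : q < 1)
    (μ ν : EuclideanSpace ℝ (Fin p)) {s : ℝ} (hs : 0 < s)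
    (V : NNReal) (hV : ‖μ - ν‖ ^ 2 / s ^ 2 ≤ V) :
    ∫⁻ x, ENNReal.ofReal (renyiInt α ((1 - q) * gaussND ν s x + q * gaussND μ s x)
      (gaussND ν s x)) ≤ ENNReal.ofReal (mixMoment α V q) := by
  have hv0 : 0 ≤ ‖μ - ν‖ ^ 2 / s ^ 2 := by positivity
  rw [lintegral_renyiInt_mix_eq (by linarith) hq0 hq1 μ ν hs ⟨_, hv0⟩ rfl]
  exact ENNReal.ofReal_le_ofReal (mixMoment_mono_var hα.le hq0 hq1 (by exact_mod_cast hV))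

theorem gaussND_reflect (μ ν : EuclideanSpace ℝ (Fin p)) (s : ℝ) (x : EuclideanSpace ℝ (Fin p)) :
    gaussND ν s (μ + ν - x) = gaussND μ s x := by
  unfold gaussND
  rw [show μ + ν - x - ν = -(x - μ) by abel, norm_neg]

theorem lintegral_gaussND_swap (μ ν : EuclideanSpace ℝ (Fin p)) (s : ℝ) (F : ℝ → ℝ → ENNReal) :
    ∫⁻ x, F (gaussND μ s x) (gaussND ν s x) = ∫⁻ x, F (gaussND ν s x) (gaussND μ s x) := by
  rw [← lintegral_sub_left_eq_self _ (μ + ν)]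
  refine lintegral_congr fun x => ?_
  rw [gaussND_reflect]
  conv_lhs => rw [add_comm μ ν, gaussND_reflect]

theorem lintegral_renyiInt_mix_right_le {α q : ℝ} (hα : 1 < α) (hq0 : 0 ≤ q) (hq1 : q < 1)
    (μ ν : EuclideanSpace ℝ (Fin p)) {s : ℝ} (hs : 0 < s)
    (V : NNReal) (hV : ‖μ - ν‖ ^ 2 / s ^ 2 ≤ V) :
    ∫⁻ x, ENNReal.ofReal (renyiInt α (gaussND ν s x)
      ((1 - q) * gaussND ν s x + q * gaussND μ s x)) ≤ ENNReal.ofReal (mixMoment α V q) := by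
  refine le_trans ?_ (lintegral_renyiInt_mix_le hα hq0 hq1 μ ν hs V hV)
  set F : ℝ → ℝ → ENNReal := fun a b => ENNReal.ofReal (renyiInt α b ((1 - q) * b + q * a))
    with hF
  set G : ℝ → ℝ → ENNReal := fun a b => ENNReal.ofReal (renyiInt α ((1 - q) * b + q * a) b)
    with hG
  have hFm : ∀ μ ν : EuclideanSpace ℝ (Fin p),
      Measurable fun x => F (gaussND μ s x) (gaussND ν s x) := by
    intro μ ν
    have h1 := (continuous_gaussND μ s).measurable
    have h2 := (continuous_gaussND ν s).measurable
    simp only [hF, renyiInt]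
    fun_prop
  have hGm : ∀ μ ν : EuclideanSpace ℝ (Fin p),
      Measurable fun x => G (gaussND μ s x) (gaussND ν s x) := by
    intro μ ν
    have h1 := (continuous_gaussND μ s).measurable
    have h2 := (continuous_gaussND ν s).measurable
    simp only [hG, renyiInt]
    fun_prop
  have key : ∫⁻ x, (F (gaussND μ s x) (gaussND ν s x) + F (gaussND ν s x) (gaussND μ s x)) ≤
      ∫⁻ x, (G (gaussND μ s x) (gaussND ν s x) + G (gaussND ν s x) (gaussND μ s x)) := by
    refine lintegral_mono fun x => ?_
    have ha := gaussND_pos μ hs x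
    have hb := gaussND_pos ν hs x
    have hq1' : 0 < 1 - q := by linarith
    simp only [hF, hG, renyiInt]
    rw [← ENNReal.ofReal_add (by positivity) (by positivity),
      ← ENNReal.ofReal_add (by positivity) (by positivity)]
    exact ENNReal.ofReal_le_ofReal (mix_div_rpow_pair_le hα hq0 hq1 ha hb)
  rw [lintegral_add_left (hFm μ ν), lintegral_add_left (hGm μ ν), ← lintegral_gaussND_swap μ ν s F,
    ← lintegral_gaussND_swap μ ν s G, ← two_mul, ← two_mul] at key
  exact (ENNReal.mul_le_mul_iff_right two_ne_zero (by simp)).1 key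

end GaussianComparison

section Subsampling

theorem sum_powersetCard_succ_univ {n : ℕ} (k : ℕ) (i : Fin (n + 1))
    (f : Finset (Fin (n + 1)) → ℝ) :
    ∑ b ∈ powersetCard (k + 1) univ, f b =
      ∑ c ∈ powersetCard (k + 1) univ, f (c.map i.succAboveEmb) +
        ∑ c ∈ powersetCard k univ, f (insert i (c.map i.succAboveEmb)) := by
  have hi : ∀ c : Finset (Fin n), i ∉ c.map i.succAboveEmb := by
    intro c hc
    obtain ⟨j, -, hj⟩ := mem_map.1 hc
    exact Fin.succAbove_ne i j hj
  rw [Fin.univ_succAbove n i, cons_eq_insert, powersetCard_succ_insert (hi univ),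
    sum_union, powersetCard_map, powersetCard_map, sum_map, sum_image, sum_map]
  · rfl
  · intro b hb c hc hbc
    simp only [coe_map, Set.mem_image, mem_coe] at hb hc
    obtain ⟨b', -, rfl⟩ := hb
    obtain ⟨c', -, rfl⟩ := hc
    change b'.map i.succAboveEmb = c'.map i.succAboveEmb
    rw [← erase_insert (hi b'), ← erase_insert (hi c')]
    exact congrArg (fun t => t.erase i) hbc
  · rw [disjoint_left]
    intro b hb hb'
    obtain ⟨c, -, rfl⟩ := mem_image.1 hb'
    exact hi univ ((mem_powersetCard.1 hb).1 (mem_insert_self _ _))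

theorem sum_powersetCard_sum_erase {n k : ℕ} (G : Finset (Fin n) → ℝ) :
    ∑ c ∈ powersetCard (k + 1) (univ : Finset (Fin n)), ∑ j ∈ c, G (c.erase j) =
      ((n - k : ℕ) : ℝ) * ∑ b ∈ powersetCard k (univ : Finset (Fin n)), G b := by
  have h : ∑ c ∈ powersetCard (k + 1) (univ : Finset (Fin n)), ∑ j ∈ c, G (c.erase j) =
      ∑ b ∈ powersetCard k (univ : Finset (Fin n)), ∑ _j ∈ bᶜ, G b := by
    rw [sum_sigma', sum_sigma']
    refine sum_bij' (fun x _ => ⟨x.1.erase x.2, x.2⟩) (fun x _ => ⟨insert x.2 x.1, x.2⟩)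
      ?_ ?_ ?_ ?_ ?_
    · rintro ⟨c, j⟩ h
      simp only [mem_sigma, mem_powersetCard, subset_univ, true_and, mem_compl] at h ⊢
      exact ⟨by rw [card_erase_of_mem h.2, h.1, Nat.add_sub_cancel], notMem_erase _ _⟩
    · rintro ⟨c, j⟩ h
      simp only [mem_sigma, mem_powersetCard, subset_univ, true_and, mem_compl] at h ⊢
      exact ⟨by rw [card_insert_of_notMem h.2, h.1], mem_insert_self _ _⟩
    · rintro ⟨c, j⟩ h
      simp only [mem_sigma] at h
      simp [insert_erase h.2]
    · rintro ⟨c, j⟩ h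
      simp only [mem_sigma, mem_compl] at h
      simp [erase_insert h.2]
    · rintro ⟨c, j⟩ h
      rfl
  rw [h, mul_sum]
  refine sum_congr rfl fun b hb => ?_
  rw [sum_const, card_compl, (mem_powersetCard.1 hb).2, Fintype.card_fin, nsmul_eq_mul]

/-- Average over batches of size `k + 1` in `n + 1` points, decomposed by coupling a batch that
contains the point `i` with the batch in which `i` is replaced by another point. -/
theorem batch_average_succAbove {n k : ℕ} (hkn : k + 1 ≤ n) (i : Fin (n + 1))
    (f : Finset (Fin (n + 1)) → ℝ) :
    ((n + 1).choose (k + 1) : ℝ)⁻¹ * ∑ b ∈ powersetCard (k + 1) univ, f b =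
      ∑ y ∈ (powersetCard (k + 1) (univ : Finset (Fin n))).sigma fun c => c,
        (((k + 1 : ℕ) : ℝ) * (n.choose (k + 1) : ℝ))⁻¹ *
          ((1 - ((k + 1 : ℕ) : ℝ) / ((n + 1 : ℕ) : ℝ)) * f (y.1.map i.succAboveEmb) +
            ((k + 1 : ℕ) : ℝ) / ((n + 1 : ℕ) : ℝ) *
              f (insert i ((y.1.erase y.2).map i.succAboveEmb))) := by
  have hconst : ∑ c ∈ powersetCard (k + 1) (univ : Finset (Fin n)),
      ∑ _j ∈ c, f (c.map i.succAboveEmb) =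
      ((k + 1 : ℕ) : ℝ) * ∑ c ∈ powersetCard (k + 1) univ, f (c.map i.succAboveEmb) := by
    rw [mul_sum]
    refine sum_congr rfl fun c hc => ?_
    rw [sum_const, (mem_powersetCard.1 hc).2, nsmul_eq_mul]
  rw [← mul_sum, sum_sigma]
  simp only [sum_add_distrib, ← mul_sum]
  rw [hconst, sum_powersetCard_sum_erase fun b => f (insert i (b.map i.succAboveEmb)),
    sum_powersetCard_succ_univ k i f]
  have h1 : ((n : ℝ) + 1) * n.choose k = (n + 1).choose (k + 1) * (k + 1) := by
    exact_mod_cast Nat.add_one_mul_choose_eq n k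
  have h2 : (n.choose (k + 1) : ℝ) * (k + 1) = n.choose k * ((n : ℝ) - k) := by
    rw [← Nat.cast_sub (by omega)]
    exact_mod_cast Nat.choose_succ_right_eq n k
  have h3 : (0 : ℝ) < n.choose (k + 1) := by exact_mod_cast Nat.choose_pos hkn
  have h4 : (0 : ℝ) < n.choose k := by exact_mod_cast Nat.choose_pos (by omega)
  have h5 : (0 : ℝ) < (n + 1).choose (k + 1) := by exact_mod_cast Nat.choose_pos (by omega)
  have h6 : (0 : ℝ) < (n : ℝ) - k := by
    have : (k : ℝ) + 1 ≤ n := by exact_mod_cast hkn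
    linarith
  rw [Nat.cast_sub (by omega)]
  push_cast
  have e1 : ((n + 1).choose (k + 1) : ℝ) = (n + 1) * n.choose k / (k + 1) := by
    rw [h1]; field_simp
  have e2 : (n.choose (k + 1) : ℝ) = n.choose k * ((n : ℝ) - k) / (k + 1) := by
    rw [← h2]; field_simp
  rw [e1, e2]
  field_simp
  ring

theorem renyiInt_nonneg {α a b : ℝ} (ha : 0 ≤ a) (hb : 0 ≤ b) : 0 ≤ renyiInt α a b := by
  unfold renyiInt
  positivity

/-- Joint convexity of the Rényi integrand. -/
theorem renyiInt_sum_le {ι : Type*} {α : ℝ} (hα : 1 ≤ α) (S : Finset ι) (hS : S.Nonempty)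
    {w : ℝ} (hw : 0 < w) (P Q : ι → ℝ) (hP : ∀ y, 0 ≤ P y) (hQ : ∀ y, 0 < Q y) :
    renyiInt α (∑ y ∈ S, w * P y) (∑ y ∈ S, w * Q y) ≤ ∑ y ∈ S, w * renyiInt α (P y) (Q y) := by
  set B := ∑ y ∈ S, w * Q y with hB
  have hBpos : 0 < B := sum_pos (fun y _ => mul_pos hw (hQ y)) hS
  have h := Real.rpow_arith_mean_le_arith_mean_rpow S (fun y => w * Q y / B)
    (fun y => P y / Q y) (fun y _ => (div_pos (mul_pos hw (hQ y)) hBpos).le)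
    (by rw [← sum_div, ← hB, div_self hBpos.ne'])
    (fun y _ => div_nonneg (hP y) (hQ y).le) hα
  have he : ∑ y ∈ S, w * Q y / B * (P y / Q y) = (∑ y ∈ S, w * P y) / B := by
    rw [sum_div]
    refine sum_congr rfl fun y _ => ?_
    have := (hQ y).ne'
    field_simp
  rw [he] at h
  unfold renyiInt
  refine (mul_le_mul_of_nonneg_right h hBpos.le).trans_eq ?_
  rw [sum_mul]
  refine sum_congr rfl fun y _ => ?_
  field_simp

theorem measurable_renyiInt {Ω : Type*} [MeasurableSpace Ω] (α : ℝ) {P Q : Ω → ℝ}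
    (hP : Measurable P) (hQ : Measurable Q) : Measurable fun x => renyiInt α (P x) (Q x) := by
  unfold renyiInt
  fun_prop

theorem lintegral_renyiInt_sum_le {ι Ω : Type*} [MeasurableSpace Ω] {m : Measure Ω} {α : ℝ}
    (hα : 1 ≤ α) (S : Finset ι) {w : ℝ} (hw : 0 < w) (hwS : #S * w = 1) (P Q : ι → Ω → ℝ)
    (hPm : ∀ y, Measurable (P y)) (hQm : ∀ y, Measurable (Q y))
    (hP : ∀ y x, 0 ≤ P y x) (hQ : ∀ y x, 0 < Q y x) {B : ENNReal}
    (hB : ∀ y ∈ S, ∫⁻ x, ENNReal.ofReal (renyiInt α (P y x) (Q y x)) ∂m ≤ B) :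
    ∫⁻ x, ENNReal.ofReal (renyiInt α (∑ y ∈ S, w * P y x) (∑ y ∈ S, w * Q y x)) ∂m ≤ B := by
  have hS : S.Nonempty := by
    rw [nonempty_iff_ne_empty]
    rintro rfl
    simp at hwS
  calc _ ≤ ∫⁻ x, ∑ y ∈ S, ENNReal.ofReal w * ENNReal.ofReal (renyiInt α (P y x) (Q y x)) ∂m := by
        refine lintegral_mono fun x => ?_
        refine (ENNReal.ofReal_le_ofReal (renyiInt_sum_le hα S hS hw (fun y => P y x)
          (fun y => Q y x) (fun y => hP y x) fun y => hQ y x)).trans_eq ?_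
        rw [ENNReal.ofReal_sum_of_nonneg fun y _ =>
          mul_nonneg hw.le (renyiInt_nonneg (hP y x) (hQ y x).le)]
        exact sum_congr rfl fun y _ => ENNReal.ofReal_mul hw.le
    _ = ∑ y ∈ S, ENNReal.ofReal w * ∫⁻ x, ENNReal.ofReal (renyiInt α (P y x) (Q y x)) ∂m := by
        have hm := fun y => (measurable_renyiInt α (hPm y) (hQm y)).ennreal_ofReal
        rw [lintegral_finsetSum _ fun y _ => (hm y).const_mul _]
        exact sum_congr rfl fun y _ => lintegral_const_mul _ (hm y)
    _ ≤ ∑ _y ∈ S, ENNReal.ofReal w * B := sum_le_sum fun y hy => by gcongr; exact hB y hy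
    _ = B := by
        rw [sum_const, nsmul_eq_mul, ← mul_assoc, ← ENNReal.ofReal_natCast,
          ← ENNReal.ofReal_mul (Nat.cast_nonneg _), hwS, ENNReal.ofReal_one, one_mul]

theorem norm_clip_le {E : Type*} [NormedAddCommGroup E] [NormedSpace ℝ E] {C : ℝ} (hC : 0 < C)
    (x : E) : ‖clip C x‖ ≤ C := by
  have h : 0 < max 1 (‖x‖ / C) := lt_max_of_lt_left one_pos
  rw [clip, norm_smul, norm_inv, Real.norm_of_nonneg h.le, inv_mul_le_iff₀ h]
  calc ‖x‖ = ‖x‖ / C * C := by field_simp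
    _ ≤ _ := by gcongr; exact le_max_right _ _

variable {X : Type*} {p : ℕ}

theorem muStep_map_succAbove {n : ℕ} (C η : ℝ) (k : ℕ)
    (g : EuclideanSpace ℝ (Fin p) → X → EuclideanSpace ℝ (Fin p)) (θ : EuclideanSpace ℝ (Fin p))
    (i : Fin (n + 1)) (c : Finset (Fin n)) (D : Fin (n + 1) → X) :
    muStep C η k g θ (c.map i.succAboveEmb) D = muStep C η k g θ c (removeIdx i D) := by
  simp [muStep, removeIdx]

theorem norm_muStep_swap_sq_le {n : ℕ} {C η σ : ℝ} (hC : 0 < C) (hη : 0 < η) (hσ : 0 < σ)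
    {k : ℕ} (hk : 0 < k)
    (g : EuclideanSpace ℝ (Fin p) → X → EuclideanSpace ℝ (Fin p)) (θ : EuclideanSpace ℝ (Fin p))
    (i : Fin (n + 1)) {c : Finset (Fin n)} {j : Fin n} (hj : j ∈ c) (D : Fin (n + 1) → X) :
    ‖muStep C η k g θ (insert i ((c.erase j).map i.succAboveEmb)) D -
      muStep C η k g θ (c.map i.succAboveEmb) D‖ ^ 2 / (C * η * σ / k) ^ 2 ≤ 4 / σ ^ 2 := by
  have hi : i ∉ (c.erase j).map i.succAboveEmb := by
    intro hc
    obtain ⟨l, -, hl⟩ := mem_map.1 hc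
    exact Fin.succAbove_ne i l hl
  have hk' : (0 : ℝ) < k := by exact_mod_cast hk
  have hd : muStep C η k g θ (insert i ((c.erase j).map i.succAboveEmb)) D -
      muStep C η k g θ (c.map i.succAboveEmb) D =
      (η / k) • (clip C (g θ (D (i.succAbove j))) - clip C (g θ (D i))) := by
    simp only [muStep]
    rw [sum_insert hi, sum_map, sum_map, ← add_sum_erase c _ hj]
    simp only [Fin.succAboveEmb_apply]
    module
  have hn : ‖clip C (g θ (D (i.succAbove j))) - clip C (g θ (D i))‖ ≤ 2 * C :=
    (norm_sub_le _ _).trans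
      (by linarith [norm_clip_le hC (g θ (D (i.succAbove j))), norm_clip_le hC (g θ (D i))])
  have hr : 0 ≤ η / k := by positivity
  rw [hd, norm_smul, Real.norm_of_nonneg hr, div_le_iff₀ (by positivity)]
  calc (η / k * ‖clip C (g θ (D (i.succAbove j))) - clip C (g θ (D i))‖) ^ 2
      ≤ (η / k * (2 * C)) ^ 2 := by gcongr
    _ = 4 / σ ^ 2 * (C * η * σ / k) ^ 2 := by field_simp; ring

theorem card_batch_sigma {n k : ℕ} (hkn : k + 1 ≤ n) :
    (#((powersetCard (k + 1) (univ : Finset (Fin n))).sigma fun c => c) : ℝ) *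
      (((k + 1 : ℕ) : ℝ) * (n.choose (k + 1) : ℝ))⁻¹ = 1 := by
  have h : #((powersetCard (k + 1) (univ : Finset (Fin n))).sigma fun c => c) =
      (k + 1) * n.choose (k + 1) := by
    rw [card_sigma, sum_congr rfl fun c hc => (mem_powersetCard.1 hc).2, sum_const,
      card_powersetCard, card_univ, Fintype.card_fin, smul_eq_mul, mul_comm]
  rw [h, Nat.cast_mul]
  have h3 : (0 : ℝ) < n.choose (k + 1) := by exact_mod_cast Nat.choose_pos hkn
  exact mul_inv_cancel₀ (by positivity)

theorem pFSwoR_removeIdx {n k : ℕ} (hkn : k + 1 ≤ n) (C η σ : ℝ)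
    (g : EuclideanSpace ℝ (Fin p) → X → EuclideanSpace ℝ (Fin p)) (i : Fin (n + 1))
    (D : Fin (n + 1) → X) (θ x : EuclideanSpace ℝ (Fin p)) :
    pFSwoR C η σ (k + 1) g n (removeIdx i D) θ x =
      ∑ y ∈ (powersetCard (k + 1) (univ : Finset (Fin n))).sigma fun c => c,
        (((k + 1 : ℕ) : ℝ) * (n.choose (k + 1) : ℝ))⁻¹ *
          gaussND (muStep C η (k + 1) g θ (y.1.map i.succAboveEmb) D)
            (C * η * σ / (k + 1 : ℕ)) x := by
  simp only [muStep_map_succAbove]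
  rw [← mul_sum, sum_sigma, pFSwoR]
  have h : ∀ c ∈ powersetCard (k + 1) (univ : Finset (Fin n)),
      ∑ _j ∈ c, gaussND (muStep C η (k + 1) g θ c (removeIdx i D)) (C * η * σ / (k + 1 : ℕ)) x =
      ((k + 1 : ℕ) : ℝ) * gaussND (muStep C η (k + 1) g θ c (removeIdx i D))
        (C * η * σ / (k + 1 : ℕ)) x := fun c hc => by
    rw [sum_const, (mem_powersetCard.1 hc).2, nsmul_eq_mul]
  rw [sum_congr rfl h, ← mul_sum, ← mul_assoc]
  congr 1
  have h3 : (0 : ℝ) < n.choose (k + 1) := by exact_mod_cast Nat.choose_pos hkn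
  field_simp

theorem pFSwoR_pos {n k : ℕ} (hkn : k ≤ n) {C η σ : ℝ} (hs : 0 < C * η * σ / k)
    (g : EuclideanSpace ℝ (Fin p) → X → EuclideanSpace ℝ (Fin p))
    (D : Fin n → X) (θ x : EuclideanSpace ℝ (Fin p)) : 0 < pFSwoR C η σ k g n D θ x := by
  have h : (0 : ℝ) < n.choose k := by exact_mod_cast Nat.choose_pos hkn
  refine mul_pos (inv_pos.2 h) (sum_pos (fun b _ => gaussND_pos _ hs x) ?_)
  exact powersetCard_nonempty.2 (by simpa using hkn)

/-- One-step bounds for removing and for adding a data point. -/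
theorem lintegral_renyiInt_pFSwoR_removeIdx_le {n k : ℕ} (hkn : k + 1 ≤ n) {C η σ α : ℝ}
    (hα : 1 < α) (hC : 0 < C) (hη : 0 < η) (hσ : 0 < σ) (V : NNReal) (hV : (V : ℝ) = 4 / σ ^ 2)
    (g : EuclideanSpace ℝ (Fin p) → X → EuclideanSpace ℝ (Fin p)) (i : Fin (n + 1))
    (D : Fin (n + 1) → X) (θ : EuclideanSpace ℝ (Fin p)) :
    ∫⁻ x, ENNReal.ofReal (renyiInt α (pFSwoR C η σ (k + 1) g (n + 1) D θ x)
        (pFSwoR C η σ (k + 1) g n (removeIdx i D) θ x)) ≤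
      ENNReal.ofReal (mixMoment α V (((k + 1 : ℕ) : ℝ) / ((n + 1 : ℕ) : ℝ))) ∧
    ∫⁻ x, ENNReal.ofReal (renyiInt α (pFSwoR C η σ (k + 1) g n (removeIdx i D) θ x)
        (pFSwoR C η σ (k + 1) g (n + 1) D θ x)) ≤
      ENNReal.ofReal (mixMoment α V (((k + 1 : ℕ) : ℝ) / ((n + 1 : ℕ) : ℝ))) := by
  have hs : 0 < C * η * σ / (k + 1 : ℕ) := by positivity
  set s := C * η * σ / (k + 1 : ℕ) with hsdef
  set q : ℝ := ((k + 1 : ℕ) : ℝ) / ((n + 1 : ℕ) : ℝ) with hq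
  have hq0 : 0 ≤ q := by positivity
  have hq1 : q < 1 := by
    rw [hq, div_lt_one (by positivity)]
    exact_mod_cast (by omega : k + 1 < n + 1)
  have hD : ∀ x, pFSwoR C η σ (k + 1) g (n + 1) D θ x = _ := fun x =>
    batch_average_succAbove hkn i fun b => gaussND (muStep C η (k + 1) g θ b D) s x
  have hw : 0 < (((k + 1 : ℕ) : ℝ) * (n.choose (k + 1) : ℝ))⁻¹ := by
    have h3 : (0 : ℝ) < n.choose (k + 1) := by exact_mod_cast Nat.choose_pos hkn
    positivity
  have hm := fun b : Finset (Fin (n + 1)) =>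
    (continuous_gaussND (muStep C η (k + 1) g θ b D) s).measurable
  have hpos := fun (b : Finset (Fin (n + 1))) x => gaussND_pos (muStep C η (k + 1) g θ b D) hs x
  have hmixm : ∀ b c : Finset (Fin (n + 1)), Measurable fun x =>
      (1 - q) * gaussND (muStep C η (k + 1) g θ b D) s x +
        q * gaussND (muStep C η (k + 1) g θ c D) s x := fun b c =>
    ((hm b).const_mul _).add ((hm c).const_mul _)
  have hmixpos : ∀ (b c : Finset (Fin (n + 1))) x, 0 <
      (1 - q) * gaussND (muStep C η (k + 1) g θ b D) s x +
        q * gaussND (muStep C η (k + 1) g θ c D) s x := fun b c x =>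
    add_pos_of_pos_of_nonneg (mul_pos (by linarith) (hpos b x)) (mul_nonneg hq0 (hpos c x).le)
  simp only [hD, pFSwoR_removeIdx hkn]
  constructor
  · refine lintegral_renyiInt_sum_le hα.le _ hw (card_batch_sigma hkn) _ _
      (fun y => hmixm _ _) (fun y => hm _) (fun y x => (hmixpos _ _ x).le) (fun y x => hpos _ x) ?_
    intro y hy
    refine lintegral_renyiInt_mix_le hα hq0 hq1 _ _ hs V ?_
    rw [hV]
    exact norm_muStep_swap_sq_le hC hη hσ k.succ_pos g θ i (mem_sigma.1 hy).2 D
  · refine lintegral_renyiInt_sum_le hα.le _ hw (card_batch_sigma hkn) _ _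
      (fun y => hm _) (fun y => hmixm _ _) (fun y x => (hpos _ x).le) (fun y x => hmixpos _ _ x) ?_
    intro y hy
    refine lintegral_renyiInt_mix_right_le hα hq0 hq1 _ _ hs V ?_
    rw [hV]
    exact norm_muStep_swap_sq_le hC hη hσ k.succ_pos g θ i (mem_sigma.1 hy).2 D

/-- The one-step Rényi bound for add/remove adjacent datasets. -/
theorem lintegral_renyiInt_pFSwoR_le {nD nD' k : ℕ} (hk : 1 ≤ k) {D : Fin nD → X}
    {D' : Fin nD' → X} (hadj : AdjAddRemove D D') (hkmin : k ≤ min nD nD')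
    (hq : (k : ℝ) / nD < 1) {C η σ α : ℝ}
    (hα : 1 < α) (hC : 0 < C) (hη : 0 < η) (hσ : 0 < σ)
    (g : EuclideanSpace ℝ (Fin p) → X → EuclideanSpace ℝ (Fin p))
    (θ : EuclideanSpace ℝ (Fin p)) :
    ∫⁻ x, ENNReal.ofReal (renyiInt α (pFSwoR C η σ k g nD D θ x) (pFSwoR C η σ k g nD' D' θ x)) ≤
      ENNReal.ofReal (1 + ((k : ℝ) / nD) ^ 2 / 2 * (α * (α - 1)) * Mcoef σ 2 +
        Rtil3 α σ ((k : ℝ) / nD)) := by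
  have hq0 : 0 ≤ (k : ℝ) / nD := by positivity
  have hV0 : 0 ≤ 4 / σ ^ 2 := by positivity
  refine le_trans ?_ (ENNReal.ofReal_le_ofReal
    (mixMoment_le hα hσ hq0 hq ⟨_, hV0⟩ rfl))
  obtain ⟨k, rfl⟩ : ∃ l, k = l + 1 := ⟨k - 1, by omega⟩
  rcases hadj with ⟨rfl, i, rfl⟩ | ⟨rfl, i, rfl⟩
  · exact (lintegral_renyiInt_pFSwoR_removeIdx_le (by omega) hα hC hη hσ ⟨_, hV0⟩ rfl g i D θ).1
  · have hn : 0 < nD := by omega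
    refine (lintegral_renyiInt_pFSwoR_removeIdx_le (by omega) hα hC hη hσ ⟨_, hV0⟩ rfl
      g i D' θ).2.trans (ENNReal.ofReal_le_ofReal
        (mixMoment_mono_rate hα.le (by positivity) ?_ hq _))
    gcongr
    exact nD.le_succ

end Subsampling

/-- Iterated integrals of products of transition functions along a path. -/
theorem lintegral_chain_le {E : Type*} [MeasureSpace E] [SigmaFinite (volume : Measure E)]
    (T : ℕ) (K : ℕ → E → E → ENNReal) (B : ℕ → ENNReal) (hKtop : ∀ t θ x, K t θ x ≠ ⊤)
    (hBtop : ∀ t, B t ≠ ⊤)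
    (hK : ∀ t < T, ∀ θ, ∫⁻ x, K t θ x ≤ B t) (θ₀ : E) :
    ∫⁻ x : Fin T → E, ∏ t : Fin T, K t
      (if 0 < (t : ℕ) then
        x ⟨(t : ℕ) - 1, Nat.lt_of_le_of_lt (Nat.sub_le _ _) t.isLt⟩
      else θ₀) (x t) ≤ ∏ t ∈ range T, B t := by
  induction T generalizing K B θ₀ with
  | zero => simp [volume_pi]
  | succ T ih =>
    set e := MeasurableEquiv.piFinSuccAbove (fun _ : Fin (T + 1) => E) 0 with he
    have hmp := (volume_preserving_piFinSuccAbove (fun _ : Fin (T + 1) => E) 0).symm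
    rw [← hmp.lintegral_comp_emb (MeasurableEquiv.measurableEmbedding _)]
    refine (lintegral_prod_le _).trans ?_
    rw [prod_range_succ']
    have hsplit : ∀ (a : E) (y : Fin T → E), ∏ t : Fin (T + 1), K t
        (if 0 < (t : ℕ) then e.symm (a, y)
          ⟨(t : ℕ) - 1, Nat.lt_of_le_of_lt (Nat.sub_le _ _) t.isLt⟩ else θ₀) (e.symm (a, y) t) =
        K 0 θ₀ a * ∏ t : Fin T, K (t + 1)
          (if 0 < (t : ℕ) then y ⟨(t : ℕ) - 1, Nat.lt_of_le_of_lt (Nat.sub_le _ _) t.isLt⟩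
            else a) (y t) := by
      intro a y
      have hy0 : e.symm (a, y) 0 = a := by simp [he, MeasurableEquiv.piFinSuccAbove]
      have hys : ∀ t : Fin T, e.symm (a, y) t.succ = y t := fun t => by
        simp [he, MeasurableEquiv.piFinSuccAbove]
      rw [Fin.prod_univ_succ]
      refine congrArg₂ (· * ·) ?_ ?_
      · exact congrArg (K 0 θ₀) hy0
      · refine prod_congr rfl fun t _ => ?_
        rw [hys, if_pos (by simp)]
        refine congrArg (fun z => K (t + 1) z (y t)) ?_
        split_ifs with ht
        · rw [← hys]
          refine congrArg (e.symm (a, y)) (Fin.ext ?_)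
          simp
          omega
        · rw [← hy0]
          refine congrArg (e.symm (a, y)) (Fin.ext ?_)
          simp
          omega
    calc _ ≤ ∫⁻ a, K 0 θ₀ a * ∏ t ∈ range T, B (t + 1) := by
          refine lintegral_mono fun a => ?_
          refine (lintegral_congr (hsplit a)).le.trans ?_
          rw [lintegral_const_mul' _ _ (hKtop 0 θ₀ a)]
          gcongr
          exact ih (fun t => K (t + 1)) (fun t => B (t + 1)) (fun t => hKtop _) (fun t => hBtop _)
            (fun t ht => hK (t + 1) (Nat.succ_lt_succ ht)) a
      _ ≤ _ := by
          rw [lintegral_mul_const' _ _ (ENNReal.prod_ne_top fun t _ => hBtop _), mul_comm]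
          gcongr
          exact hK 0 (Nat.succ_pos _) θ₀

theorem Mcoef_two_nonneg (σ : ℝ) : 0 ≤ Mcoef σ 2 := by
  refine integral_nonneg fun x => mul_nonneg (sq_nonneg _) ?_
  unfold gauss1
  positivity

theorem renyiDiv_le_of_lintegral_le {Ω : Type*} [MeasurableSpace Ω] {ν : Measure Ω} {α b : ℝ}
    (hα : 1 < α) {P Q : Ω → ℝ} (hP : ∀ x, 0 ≤ P x) (hQ : ∀ x, 0 ≤ Q x) (hb : 1 ≤ b)
    (h : ∫⁻ x, ENNReal.ofReal (renyiInt α (P x) (Q x)) ∂ν ≤ ENNReal.ofReal b) :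
    renyiDiv ν α P Q ≤ (α - 1)⁻¹ * Real.log b := by
  have hα' : 0 < (α - 1)⁻¹ := inv_pos.2 (by linarith)
  refine mul_le_mul_of_nonneg_left ?_ hα'.le
  have hnn : ∀ x, 0 ≤ renyiInt α (P x) (Q x) := fun x => renyiInt_nonneg (hP x) (hQ x)
  change Real.log (∫ x, renyiInt α (P x) (Q x) ∂ν) ≤ _
  have hle : ∫ x, renyiInt α (P x) (Q x) ∂ν ≤ b := by
    by_cases hi : Integrable (fun x => renyiInt α (P x) (Q x)) ν
    · rwa [← ofReal_integral_eq_lintegral_ofReal hi (Filter.Eventually.of_forall hnn),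
        ENNReal.ofReal_le_ofReal_iff (by linarith)] at h
    · rw [integral_undef hi]
      linarith
  rcases (integral_nonneg (μ := ν) (Pi.le_def.2 hnn)).eq_or_lt with h0 | h0
  · rw [← show 0 = ∫ x, renyiInt α (P x) (Q x) ∂ν from h0, Real.log_zero]
    exact Real.log_nonneg hb
  · exact Real.log_le_log h0 hle

theorem renyiInt_prod {ι : Type*} (S : Finset ι) (α : ℝ) (P Q : ι → ℝ) (hP : ∀ y ∈ S, 0 ≤ P y)
    (hQ : ∀ y ∈ S, 0 ≤ Q y) :
    renyiInt α (∏ y ∈ S, P y) (∏ y ∈ S, Q y) = ∏ y ∈ S, renyiInt α (P y) (Q y) := by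
  unfold renyiInt
  rw [prod_mul_distrib, ← prod_div_distrib,
    Real.finsetProd_rpow _ _ fun y hy => div_nonneg (hP y hy) (hQ y hy)]

/-- Rényi composition for Markov chains with uniformly bounded transition divergences. -/
theorem renyiDiv_chainDensity_le {E : Type*} [MeasureSpace E] [SigmaFinite (volume : Measure E)]
    {α : ℝ} (hα : 1 < α) (T : ℕ) (P Q : ℕ → E → E → ℝ) (B : ℕ → ℝ)
    (hP : ∀ t < T, ∀ θ x, 0 ≤ P t θ x) (hQ : ∀ t < T, ∀ θ x, 0 ≤ Q t θ x)
    (hB : ∀ t < T, 1 ≤ B t)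
    (hPQ : ∀ t < T, ∀ θ, ∫⁻ x, ENNReal.ofReal (renyiInt α (P t θ x) (Q t θ x)) ≤
      ENNReal.ofReal (B t)) (θ₀ : E) :
    renyiDiv volume α (chainDensity T P θ₀) (chainDensity T Q θ₀) ≤
      ∑ t ∈ range T, (α - 1)⁻¹ * Real.log (B t) := by
  have hB' : ∀ t ∈ range T, 1 ≤ B t := fun t ht => hB t (mem_range.1 ht)
  rw [← mul_sum, ← Real.log_prod fun t ht => (one_pos.trans_le (hB' t ht)).ne']
  refine renyiDiv_le_of_lintegral_le hα (fun x => prod_nonneg fun t _ => hP t t.2 _ _)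
    (fun x => prod_nonneg fun t _ => hQ t t.2 _ _) (Finset.one_le_prod hB') ?_
  have h := lintegral_chain_le T
    (fun t θ x => ENNReal.ofReal (renyiInt α (P t θ x) (Q t θ x)))
    (fun t => ENNReal.ofReal (B t)) (fun t θ x => ENNReal.ofReal_ne_top)
    (fun t => ENNReal.ofReal_ne_top) hPQ θ₀
  rw [← ENNReal.ofReal_prod_of_nonneg fun t ht => zero_le_one.trans (hB' t ht)] at h
  refine (lintegral_mono fun x => ?_).trans h
  rw [← ENNReal.ofReal_prod_of_nonneg
    fun (t : Fin T) _ => renyiInt_nonneg (hP t t.2 _ _) (hQ t t.2 _ _)]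
  refine ENNReal.ofReal_le_ofReal (le_of_eq ?_)
  exact renyiInt_prod _ _ _ _ (fun t _ => hP t t.2 _ _) (fun t _ => hQ t t.2 _ _)

/-- T-step FSwoR-RDP upper bound, add/remove adjacency. -/
theorem stmt2 {X : Type*} {pd : ℕ} (hpd : 1 ≤ pd)
    (C : ℝ) (hC : 0 < C) (T : ℕ) (ηs σs : ℕ → ℝ)
    (hη : ∀ t < T, 0 < ηs t) (hσ : ∀ t < T, 0 < σs t)
    (k : ℕ) (hk : 1 ≤ k)
    (g : EuclideanSpace ℝ (Fin pd) → X → EuclideanSpace ℝ (Fin pd))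
    {nD nD' : ℕ} (D : Fin nD → X) (D' : Fin nD' → X)
    (hadj : AdjAddRemove D D') (hkmin : k ≤ min nD nD')
    (hq : (k : ℝ) / nD < 1)
    (θ₀ : EuclideanSpace ℝ (Fin pd)) (α : ℝ) (hα : 1 < α) :
    renyiDiv volume α
        (chainDensity T (fun t θ θ' => pFSwoR C (ηs t) (σs t) k g nD D θ θ') θ₀)
        (chainDensity T (fun t θ θ' => pFSwoR C (ηs t) (σs t) k g nD' D' θ θ') θ₀) ≤
      ∑ t ∈ Finset.range T,
        (α - 1)⁻¹ *
          Real.log (1 + ((k : ℝ) / nD) ^ 2 / 2 * (α * (α - 1)) * Mcoef (σs t) 2 +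
            Rtil3 α (σs t) ((k : ℝ) / nD)) := by
  refine renyiDiv_chainDensity_le hα T _ _ (fun t => 1 + ((k : ℝ) / nD) ^ 2 / 2 *
    (α * (α - 1)) * Mcoef (σs t) 2 + Rtil3 α (σs t) ((k : ℝ) / nD)) ?_ ?_ ?_ ?_ θ₀
  · intro t ht θ x
    have := hη t ht
    have := hσ t ht
    exact (pFSwoR_pos (hkmin.trans (min_le_left _ _)) (by positivity) g D θ x).le
  · intro t ht θ x
    have := hη t ht
    have := hσ t ht
    exact (pFSwoR_pos (hkmin.trans (min_le_right _ _)) (by positivity) g D' θ x).le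
  · intro t ht
    have h1 := Rtil3_nonneg hα (hσ t ht) (q := (k : ℝ) / nD) (by positivity) hq
    have h2 := Mcoef_two_nonneg (σs t)
    have h3 : 0 ≤ α * (α - 1) := mul_nonneg (by linarith) (by linarith)
    have h4 : 0 ≤ ((k : ℝ) / nD) ^ 2 / 2 * (α * (α - 1)) * Mcoef (σs t) 2 := by positivity
    linarith
  · exact fun t ht θ => lintegral_renyiInt_pFSwoR_le hk hadj hkmin hq hα hC (hη t ht) (hσ t ht) g θ
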